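/- arXiv:1612.01271 — 3 statements merged into one kernel-verified Lean document; each statement's English description precedes it below -/
import Mathlib

section
/- Let k ≥ 2 and let P be a convex polytope of dimension k+1. If the Euler–Poincaré relation ∑_{c=0}^{d} (-1)^c f^c = 1 holds for every convex polytope of dimension k-1 and of dimension k, then it also holds for P, i.e., ∑_{c=0}^{k+1} (-1)^c f^c(P) = 1. -/
open Set

/-- A convex polytope: the convex hull of a finite nonempty set of points. -/
def IsPolytope {n : ℕ} (P : Set (EuclideanSpace ℝ (Fin n))) : Prop :=
  ∃ S : Finset (EuclideanSpace ℝ (Fin n)), S.Nonempty ∧ P = convexHull ℝ (S : Set (EuclideanSpace ℝ (Fin n)))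

/-- The (affine) dimension of a set: the rank of the direction of its affine span. -/
noncomputable def pdim {n : ℕ} (P : Set (EuclideanSpace ℝ (Fin n))) : ℕ :=
  Module.finrank ℝ (affineSpan ℝ P).direction

/-- `F` is a (nonempty, exposed) face of `P` of dimension `c`; note `IsExposed ℝ P P` holds,
so `P` counts as the face of dimension `pdim P`. -/
def IsFaceDim {n : ℕ} (P F : Set (EuclideanSpace ℝ (Fin n))) (c : ℕ) : Prop :=
  IsExposed ℝ P F ∧ F.Nonempty ∧ pdim F = c

/-- `fc P c` is the number of faces of `P` of dimension `c`. -/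
noncomputable def fc {n : ℕ} (P : Set (EuclideanSpace ℝ (Fin n))) (c : ℕ) : ℕ :=
  {F | IsFaceDim P F c}.ncard


open Set Filter Topology Module

section EulerVal

variable {E : Type*} [AddCommGroup E] [Module ℝ E]

/-- Algebraically relatively open convex sets. -/
def RO (C : Set E) : Prop :=
  Convex ℝ C ∧ ∀ x ∈ C, ∀ y ∈ C, ∃ ε : ℝ, 0 < ε ∧ x + ε • (x - y) ∈ C

open Classical in
/-- Signed dimension of a set. -/
noncomputable def eu (C : Set E) : ℤ :=
  if C.Nonempty then (-1) ^ finrank ℝ (vectorSpan ℝ C) else 0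

open Classical in
/-- Integer indicator. -/
noncomputable def ind {X : Type*} (C : Set X) (x : X) : ℤ := if x ∈ C then 1 else 0

lemma ind_congr {X Y : Type*} {C : Set X} {D : Set Y} {x : X} {y : Y} (h : x ∈ C ↔ y ∈ D) :
    ind C x = ind D y := by
  unfold ind; split_ifs <;> tauto

lemma eu_singleton (x : E) : eu ({x} : Set E) = 1 := by
  rw [eu, if_pos (singleton_nonempty x), vectorSpan_singleton, finrank_bot, pow_zero]

lemma eu_mul_self {C : Set E} (h : C.Nonempty) : eu C * eu C = 1 := by
  simp only [eu, h, if_true, ← mul_pow]; simp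

lemma RO.dir {C : Set E} (hC : RO C) {x v : E} (hx : x ∈ C) (hv : v ∈ vectorSpan ℝ C) :
    ∃ ε : ℝ, 0 < ε ∧ x + ε • v ∈ C := by
  rw [vectorSpan_eq_span_vsub_set_right ℝ hx] at hv
  induction hv using Submodule.span_induction with
  | mem v hv =>
    obtain ⟨y, hy, rfl⟩ := hv
    exact ⟨1, one_pos, by simpa using hy⟩
  | zero => exact ⟨1, one_pos, by simpa using hx⟩
  | add v w _ _ h1 h2 =>
    obtain ⟨a, ha, h1⟩ := h1
    obtain ⟨b, hb, h2⟩ := h2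
    refine ⟨a * b / (a + b), by positivity, ?_⟩
    have := hC.1 h1 h2 (show 0 ≤ b / (a + b) by positivity) (show 0 ≤ a / (a + b) by positivity)
      (by field_simp; ring)
    convert this using 1
    match_scalars <;> field_simp
    ring
  | smul r v _ h1 =>
    obtain ⟨a, ha, h1⟩ := h1
    rcases lt_trichotomy r 0 with hr | rfl | hr
    · obtain ⟨d, hd, h2⟩ := hC.2 x hx _ h1
      refine ⟨d * a / (-r), div_pos (by positivity) (by linarith), ?_⟩
      convert h2 using 1
      have : r ≠ 0 := hr.ne
      match_scalars <;> field_simp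
      ring
    · exact ⟨1, one_pos, by simpa using hx⟩
    · refine ⟨a / r, by positivity, ?_⟩
      convert h1 using 2
      rw [smul_smul]; congr 1; field_simp

lemma RO.slice {C : Set E} (hC : RO C) (l : E →ₗ[ℝ] ℝ) (t : ℝ) : RO (C ∩ {x | l x = t}) := by
  refine ⟨?_, ?_⟩
  · refine hC.1.inter ?_
    intro x hx y hy a b _ _ hab
    simp only [mem_ofPred_eq] at *
    simp [hx, hy, ← add_mul, hab]
  · rintro x ⟨hx, hx'⟩ y ⟨hy, hy'⟩
    obtain ⟨e, he, h⟩ := hC.2 x hx y hy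
    refine ⟨e, he, h, ?_⟩
    simp only [mem_ofPred_eq] at *
    simp [hx', hy']

lemma RO.image {C : Set E} (hC : RO C) (l : E →ₗ[ℝ] ℝ) : RO (l '' C) := by
  refine ⟨hC.1.linear_image l, ?_⟩
  rintro _ ⟨x, hx, rfl⟩ _ ⟨y, hy, rfl⟩
  obtain ⟨e, he, h⟩ := hC.2 x hx y hy
  exact ⟨e, he, _, h, by simp⟩

lemma finrank_map_add [FiniteDimensional ℝ E] (W : Submodule ℝ E) (l : E →ₗ[ℝ] ℝ) :
    finrank ℝ (W.map l) + finrank ℝ (W ⊓ LinearMap.ker l : Submodule ℝ E) = finrank ℝ W := by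
  have := LinearMap.finrank_range_add_finrank_ker (l.domRestrict W)
  rw [LinearMap.range_domRestrict, LinearMap.ker_domRestrict] at this
  rw [← this]
  congr 1
  rw [← Submodule.map_comap_subtype]
  exact Submodule.finrank_map_subtype_eq W _

open Classical in
lemma eu_slice [FiniteDimensional ℝ E] {C : Set E} (hC : RO C) (l : E →ₗ[ℝ] ℝ) (t : ℝ) :
    eu (C ∩ {x | l x = t}) = (eu C * eu (l '' C)) * ind (l '' C) t := by
  by_cases ht : t ∈ l '' C
  · obtain ⟨x, hx, hxt⟩ := ht
    have hne : (C ∩ {x | l x = t}).Nonempty := ⟨x, hx, hxt⟩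
    have hC0 : C.Nonempty := ⟨x, hx⟩
    have hI : (l '' C).Nonempty := hC0.image _
    have hmem : t ∈ l '' C := ⟨x, hx, hxt⟩
    simp only [eu, ind, hne, hC0, hI, hmem, if_true, mul_one]
    have h1 : vectorSpan ℝ (C ∩ {x | l x = t}) = vectorSpan ℝ C ⊓ LinearMap.ker l := by
      apply le_antisymm
      · refine le_inf (vectorSpan_mono ℝ inter_subset_left) ?_
        rw [vectorSpan_def, Submodule.span_le]
        rintro _ ⟨y, ⟨_, hy⟩, z, ⟨_, hz⟩, rfl⟩
        simp only [mem_ofPred_eq] at hy hz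
        simp [hy, hz]
      · rintro v ⟨hv, hv'⟩
        obtain ⟨e, he, h⟩ := hC.dir hx hv
        have h2 : (x + e • v) -ᵥ x ∈ vectorSpan ℝ (C ∩ {x | l x = t}) := by
          refine vsub_mem_vectorSpan ℝ ⟨h, ?_⟩ ⟨hx, hxt⟩
          have : l v = 0 := hv'
          simp [this, hxt]
        simp only [vsub_eq_sub, add_sub_cancel_left] at h2
        exact (Submodule.smul_mem_iff _ he.ne').1 h2
    have h2 : vectorSpan ℝ (l '' C) = (vectorSpan ℝ C).map l := by
      have := AffineMap.map_vectorSpan (k := ℝ) l.toAffineMap (s := C)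
      simpa using this.symm
    rw [h1, h2, ← finrank_map_add (vectorSpan ℝ C) l, pow_add]
    have : ((-1 : ℤ) ^ finrank ℝ ((vectorSpan ℝ C).map l)) * (-1 : ℤ) ^ finrank ℝ ((vectorSpan ℝ C).map l) = 1 := by
      rw [← mul_pow]; simp
    linear_combination (-(-1 : ℤ) ^ finrank ℝ (vectorSpan ℝ C ⊓ LinearMap.ker l : Submodule ℝ E)) * this
  · have : ¬ (C ∩ {x | l x = t}).Nonempty := by
      rintro ⟨x, hx, hxt⟩; exact ht ⟨x, hx, hxt⟩
    simp [eu, ind, this, ht]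

open Classical in
lemma oneD_aux {I : Set ℝ} (hI : RO I) (hb : BddBelow I) :
    ∃ t0, ∀ t, ∀ᶠ s in 𝓝[>] t, ind I t - ind I s = if t = t0 then eu I else 0 := by
  rcases I.eq_empty_or_nonempty with rfl | hne
  · exact ⟨0, fun t => by simp [ind, eu]⟩
  by_cases hs : I.Subsingleton
  · obtain ⟨t0, rfl⟩ := (hs.eq_empty_or_singleton).resolve_left hne.ne_empty
    refine ⟨t0, fun t => ?_⟩
    have he : eu ({t0} : Set ℝ) = 1 := eu_singleton t0
    rw [he]
    rcases lt_or_ge t t0 with h | h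
    · filter_upwards [Ioo_mem_nhdsGT h] with s hs
      simp [ind, h.ne, hs.2.ne]
    · filter_upwards [self_mem_nhdsWithin] with s hs
      have : s ≠ t0 := (lt_of_le_of_lt h hs).ne'
      simp [ind, this]
  · have hnt : I.Nontrivial := not_subsingleton_iff.1 hs
    have he : eu I = -1 := by
      have : vectorSpan ℝ I = ⊤ := by
        obtain ⟨x, hx, y, hy, hxy⟩ := hnt
        have h1 : x -ᵥ y ∈ vectorSpan ℝ I := vsub_mem_vectorSpan ℝ hx hy
        rw [eq_top_iff]
        intro z _
        have : z = (z / (x - y)) • (x -ᵥ y) := by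
          have : x - y ≠ 0 := sub_ne_zero.2 hxy
          simp; field_simp
        rw [this]; exact Submodule.smul_mem _ _ h1
      rw [eu, if_pos hne, this, finrank_top]; simp
    have oc : OrdConnected I := hI.1.ordConnected
    have hup : ∀ x ∈ I, (∃ y ∈ I, y < x) ∧ ∃ y ∈ I, x < y := by
      intro x hx
      obtain ⟨y, hy, hyx⟩ := hnt.exists_ne x
      obtain ⟨e, he, h⟩ := hI.2 x hx y hy
      rw [smul_eq_mul] at h
      rcases lt_or_gt_of_ne hyx with h1 | h1
      · exact ⟨⟨y, hy, h1⟩, _, h, by nlinarith⟩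
      · exact ⟨⟨_, h, by nlinarith⟩, y, hy, h1⟩
    have hlb : ∀ x ∈ I, sInf I < x := by
      intro x hx
      obtain ⟨y, hy, h⟩ := (hup x hx).1
      exact (csInf_le hb hy).trans_lt h
    refine ⟨sInf I, fun t => ?_⟩
    rw [he]
    rcases lt_trichotomy t (sInf I) with h | h | h
    · filter_upwards [Ioo_mem_nhdsGT h] with s hs
      have h1 : t ∉ I := fun h' => absurd (hlb t h') (by linarith)
      have h2 : s ∉ I := fun h' => absurd (hlb s h') (by linarith [hs.2])
      simp [ind, h1, h2, h.ne]
    · obtain ⟨y, hy⟩ := hne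
      have h0 : t < y := h ▸ hlb y hy
      filter_upwards [Ioo_mem_nhdsGT h0] with s hs
      have h1 : t ∉ I := fun h' => absurd (hlb t h') (by linarith)
      have h2 : s ∈ I := by
        obtain ⟨z, hz, hzs⟩ := exists_lt_of_csInf_lt ⟨y, hy⟩ (h ▸ hs.1 : sInf I < s)
        exact oc.out hz hy ⟨hzs.le, hs.2.le⟩
      simp [ind, h1, h2, ← h]
    · by_cases ht : t ∈ I
      · obtain ⟨y, hy, hty⟩ := (hup t ht).2
        filter_upwards [Ioo_mem_nhdsGT hty] with s hs
        have h2 : s ∈ I := oc.out ht hy ⟨hs.1.le, hs.2.le⟩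
        simp [ind, ht, h2, h.ne']
      · filter_upwards [self_mem_nhdsWithin] with s hs
        have h2 : s ∉ I := by
          intro h'
          obtain ⟨z, hz, hzs⟩ := exists_lt_of_csInf_lt hne h
          exact ht (oc.out hz h' ⟨hzs.le, (le_of_lt hs)⟩)
        simp [ind, ht, h2, h.ne']

lemma oneD {ι : Type*} [Fintype ι] (I : ι → Set ℝ) (b : ι → ℤ) (hI : ∀ i, RO (I i))
    (hb : ∀ i, BddBelow (I i)) (h : ∀ t, ∑ i, b i * ind (I i) t = 0) :
    ∑ i, b i * eu (I i) = 0 := by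
  classical
  choose t0 ht0 using fun i => oneD_aux (hI i) (hb i)
  have key : ∀ t, ∑ i, b i * (if t = t0 i then eu (I i) else 0) = 0 := by
    intro t
    have : ∀ᶠ s in 𝓝[>] t, ∀ i, ind (I i) t - ind (I i) s = if t = t0 i then eu (I i) else 0 :=
      eventually_all.2 fun i => ht0 i t
    obtain ⟨s, hs⟩ := this.exists
    simp_rw [← hs, mul_sub, Finset.sum_sub_distrib, h]
    simp
  have := Finset.sum_congr rfl (fun t (_ : t ∈ Finset.univ.image t0) => key t)
  rw [Finset.sum_comm] at this
  simp only [Finset.sum_const_zero] at this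
  rw [← this]
  refine Finset.sum_congr rfl fun i _ => ?_
  rw [← Finset.mul_sum, Finset.sum_ite_eq']
  simp

end EulerVal

lemma val_aux {n : ℕ} {ι : Type*} [Fintype ι] (a : ι → ℤ) (B : ℝ) (m : ℕ) :
    ∀ C : ι → Set (EuclideanSpace ℝ (Fin n)), (∀ i, RO (C i)) →
    (∀ i, ∀ x ∈ C i, ∀ j, B ≤ x j) →
    (∀ i i', ∀ x ∈ C i, ∀ y ∈ C i', ∀ j : Fin n, m ≤ j → x j = y j) →
    (∀ x, ∑ i, a i * ind (C i) x = 0) → ∑ i, a i * eu (C i) = 0 := by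
  induction m with
  | zero =>
    intro C hC hB heq h
    by_cases hne : ∃ i, (C i).Nonempty
    · obtain ⟨i0, w, hw⟩ := hne
      rw [← h w]
      refine Finset.sum_congr rfl fun i _ => ?_
      congr 1
      have hsub : ∀ x ∈ C i, x = w := fun x hx => by
        ext j; exact heq i i0 x hx w hw j (Nat.zero_le _)
      by_cases hwi : w ∈ C i
      · have : C i = {w} := Subset.antisymm hsub (by simpa using hwi)
        rw [this, eu_singleton]; simp [ind]
      · have : C i = ∅ := by
          rw [eq_empty_iff_forall_notMem]; intro x hx; exact hwi (hsub x hx ▸ hx)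
        simp [this, eu, ind]
    · push Not at hne
      refine Finset.sum_eq_zero fun i _ => by simp [eu, hne i]
  | succ m IH =>
    intro C hC hB heq h
    by_cases hm : m < n
    · let l : EuclideanSpace ℝ (Fin n) →ₗ[ℝ] ℝ := (EuclideanSpace.proj (⟨m, hm⟩ : Fin n) : _ →L[ℝ] ℝ).toLinearMap
      have hl : ∀ x, l x = x ⟨m, hm⟩ := fun x => rfl
      have h1 : ∀ t, ∑ i, a i * eu (C i ∩ {x | l x = t}) = 0 := by
        intro t
        refine IH _ (fun i => (hC i).slice l t) (fun i x hx j => hB i x hx.1 j) ?_ ?_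
        · rintro i i' x ⟨hx, hxt⟩ y ⟨hy, hyt⟩ j hj
          rcases hj.eq_or_lt with h' | h'
          · have : j = ⟨m, hm⟩ := by ext; exact h'.symm
            simp only [mem_ofPred_eq, hl] at hxt hyt
            rw [this, hxt, hyt]
          · exact heq i i' x hx y hy j h'
        · intro x
          by_cases hx : l x = t
          · rw [← h x]
            refine Finset.sum_congr rfl fun i _ => ?_
            rw [ind_congr (D := C i) (y := x) (by simp [hx])]
          · simp [ind, hx]
      have h2 := oneD (fun i => l '' C i) (fun i => a i * (eu (C i) * eu (l '' C i)))
        (fun i => (hC i).image l) (fun i => ⟨B, by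
          rintro _ ⟨x, hx, rfl⟩; exact hB i x hx _⟩) (fun t => by
          rw [← h1 t]
          refine Finset.sum_congr rfl fun i _ => ?_
          rw [eu_slice (hC i)]; ring)
      rw [← h2]
      refine Finset.sum_congr rfl fun i _ => ?_
      rcases (C i).eq_empty_or_nonempty with h' | h'
      · simp [h', eu]
      · have := eu_mul_self (h'.image l)
        linear_combination (-a i * eu (C i)) * this
    · refine IH C hC hB (fun i i' x hx y hy j hj => ?_) h
      exact absurd j.2 (by omega)

lemma val {n : ℕ} {ι : Type*} [Fintype ι] (a : ι → ℤ) (B : ℝ)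
    (C : ι → Set (EuclideanSpace ℝ (Fin n))) (hC : ∀ i, RO (C i))
    (hB : ∀ i, ∀ x ∈ C i, ∀ j, B ≤ x j)
    (h : ∀ x, ∑ i, a i * ind (C i) x = 0) : ∑ i, a i * eu (C i) = 0 :=
  val_aux a B n C hC hB (fun _ _ _ _ _ _ j hj => absurd j.2 (by omega)) h

section RelInt

variable {E : Type*} [AddCommGroup E] [Module ℝ E]

/-- Algebraic relative interior. -/
def ri (F : Set E) : Set E :=
  {x | x ∈ F ∧ ∀ y ∈ F, ∃ ε : ℝ, 0 < ε ∧ x + ε • (x - y) ∈ F}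

lemma ri_subset (F : Set E) : ri F ⊆ F := fun _ h => h.1

lemma ri_seg {F : Set E} (hF : Convex ℝ F) {x z : E} (hx : x ∈ ri F) (hz : z ∈ F) {t : ℝ}
    (h0 : 0 < t) (h1 : t ≤ 1) : t • x + (1 - t) • z ∈ ri F := by
  refine ⟨hF hx.1 hz h0.le (by linarith) (by ring), fun y hy => ?_⟩
  obtain ⟨e, he, h⟩ := hx.2 y hy
  have hden : 0 < (1 - t) * e + 1 := by nlinarith
  refine ⟨t * e / ((1 - t) * e + 1), by positivity, ?_⟩
  have ha : 0 ≤ t / ((1 - t) * e + 1) := by positivity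
  have hb : 0 ≤ (1 - t) * (1 + e) / ((1 - t) * e + 1) :=
    div_nonneg (mul_nonneg (by linarith) (by linarith)) hden.le
  have := hF h hz ha hb (by field_simp; ring)
  convert this using 1
  have hz' : (1 + t * e / ((1 - t) * e + 1)) = (1 + e) / ((1 - t) * e + 1) := by
    rw [eq_div_iff hden.ne', add_mul, div_mul_cancel₀ _ hden.ne']; ring
  have hx' : t * (1 + e) / ((1 - t) * e + 1) = t * (1 + t * e / ((1 - t) * e + 1)) := by
    rw [hz']; ring
  have hz'' : (1 - t) * (1 + e) / ((1 - t) * e + 1) = (1 - t) * (1 + t * e / ((1 - t) * e + 1)) := by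
    rw [hz']; ring
  rw [hz'']
  match_scalars
  · linear_combination -hx'
  · ring
  · ring

lemma ri_ro {F : Set E} (hF : Convex ℝ F) : RO (ri F) := by
  refine ⟨?_, ?_⟩
  · intro x hx y hy a b ha hb hab
    rcases ha.eq_or_lt with rfl | ha
    · have : b = 1 := by linarith
      simpa [this] using hy
    · obtain rfl : b = 1 - a := by linarith
      exact ri_seg hF hx hy.1 ha (by linarith)
  · intro x hx y hy
    obtain ⟨e, he, h⟩ := hx.2 y hy.1
    refine ⟨e / 2, by positivity, ?_⟩
    convert ri_seg hF hx h (t := 1 / 2) (by norm_num) (by norm_num) using 1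
    match_scalars <;> ring

lemma ri_vectorSpan {F : Set E} (hF : Convex ℝ F) (hne : (ri F).Nonempty) :
    vectorSpan ℝ (ri F) = vectorSpan ℝ F := by
  apply le_antisymm (vectorSpan_mono ℝ (ri_subset F))
  obtain ⟨x, hx⟩ := hne
  rw [vectorSpan_eq_span_vsub_set_right ℝ hx.1, Submodule.span_le]
  rintro _ ⟨y, hy, rfl⟩
  have h1 := ri_seg hF hx hy (t := 1 / 2) (by norm_num) (by norm_num)
  have h2 := Submodule.smul_mem _ (2 : ℝ) (vsub_mem_vectorSpan ℝ h1 hx)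
  have h3 : (y -ᵥ x : E) = (2 : ℝ) • (((1 / 2 : ℝ) • x + (1 - 1 / 2 : ℝ) • y) -ᵥ x) := by
    simp only [vsub_eq_sub]
    match_scalars <;> norm_num
  change (y -ᵥ x : E) ∈ vectorSpan ℝ (ri F)
  rw [h3]
  exact h2

lemma eu_ri {F : Set E} (hF : Convex ℝ F) (hne : (ri F).Nonempty) :
    eu (ri F) = (-1) ^ finrank ℝ (vectorSpan ℝ F) := by
  rw [eu, if_pos hne, ri_vectorSpan hF hne]

lemma ri_convexHull_nonempty (S : Finset E) (hS : S.Nonempty) :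
    (ri (convexHull ℝ (S : Set E))).Nonempty := by
  have hc : 0 < (S.card : ℝ) := by exact_mod_cast hS.card_pos
  refine ⟨∑ s ∈ S, (1 / (S.card : ℝ)) • s, ?_, ?_⟩
  · rw [Finset.mem_convexHull']
    exact ⟨fun _ => 1 / (S.card : ℝ), fun _ _ => by positivity, by simp [hc.ne'], rfl⟩
  · intro y hy
    rw [Finset.mem_convexHull'] at hy
    obtain ⟨w, hw, hw1, rfl⟩ := hy
    refine ⟨1 / (S.card : ℝ), by positivity, ?_⟩
    rw [Finset.mem_convexHull']
    refine ⟨fun s => 1 / (S.card : ℝ) + 1 / (S.card : ℝ) * (1 / (S.card : ℝ) - w s), ?_, ?_, ?_⟩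
    · intro s hs
      have : w s ≤ 1 := by
        rw [← hw1]; exact Finset.single_le_sum hw hs
      have h2 : (1 / (S.card : ℝ) + 1 / (S.card : ℝ) * (1 / (S.card : ℝ) - w s)) =
        1 / (S.card : ℝ) * ((1 - w s) + 1 / (S.card : ℝ)) := by ring
      change 0 ≤ (1 / (S.card : ℝ) + 1 / (S.card : ℝ) * (1 / (S.card : ℝ) - w s))
      rw [h2]
      have : 0 ≤ 1 - w s := by linarith
      positivity
    · rw [Finset.sum_add_distrib, ← Finset.mul_sum, Finset.sum_sub_distrib, hw1]
      simp [hc.ne']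
    · rw [← Finset.sum_sub_distrib, Finset.smul_sum, ← Finset.sum_add_distrib]
      refine Finset.sum_congr rfl fun s _ => ?_
      module

/-- Open cone. -/
def ocone (p : E) (C : Set E) : Set E :=
  {x | ∃ t : ℝ, 0 < t ∧ t < 1 ∧ ∃ y ∈ C, x = p + t • (y - p)}

lemma RO.small {C : Set E} (hC : RO C) {x y : E} (hx : x ∈ C) (hy : y ∈ C) :
    ∃ e : ℝ, 0 < e ∧ ∀ d, 0 ≤ d → d ≤ e → x + d • (x - y) ∈ C := by
  obtain ⟨e, he, h⟩ := hC.2 x hx y hy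
  refine ⟨e, he, fun d hd hde => ?_⟩
  have := hC.1 hx h (show 0 ≤ 1 - d / e by rw [sub_nonneg, div_le_one he]; exact hde)
    (show 0 ≤ d / e by positivity) (by ring)
  convert this using 1
  match_scalars <;> field_simp <;> ring

lemma ocone_ro (p : E) {C : Set E} (hC : RO C) : RO (ocone p C) := by
  refine ⟨?_, ?_⟩
  · rintro _ ⟨t, ht, ht1, y, hy, rfl⟩ _ ⟨s, hs, hs1, z, hz, rfl⟩ a b ha hb hab
    have hr : 0 < a * t + b * s := by
      rcases ha.eq_or_lt with rfl | ha
      · have : b = 1 := by linarith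
        simp [this, hs]
      · positivity
    have hr1 : a * t + b * s < 1 := by
      rcases ha.eq_or_lt with rfl | ha
      · have : b = 1 := by linarith
        simp [this, hs1]
      · nlinarith
    refine ⟨_, hr, hr1, _, hC.1 hy hz (show 0 ≤ a * t / (a * t + b * s) by positivity)
      (show 0 ≤ b * s / (a * t + b * s) by positivity) (by field_simp), ?_⟩
    obtain rfl : b = 1 - a := by linarith
    match_scalars <;> field_simp <;> ring
  · rintro _ ⟨t, ht, ht1, y, hy, rfl⟩ _ ⟨s, hs, hs1, z, hz, rfl⟩
    obtain ⟨e, he, h⟩ := hC.small hy hz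
    -- choose d small
    obtain ⟨d, hd, hd1, hd2, hd3⟩ : ∃ d : ℝ, 0 < d ∧ t / 2 < (1 + d) * t - d * s ∧
        (1 + d) * t - d * s < 1 ∧ d * s ≤ e * (t / 2) := by
      refine ⟨min (t / 4) (min ((1 - t) / 2) (e * (t / 2))), ?_, ?_, ?_, ?_⟩
      · have : 0 < 1 - t := by linarith
        positivity
      all_goals
        have h1 := min_le_left (t / 4) (min ((1 - t) / 2) (e * (t / 2)))
        have h2 := min_le_right (t / 4) (min ((1 - t) / 2) (e * (t / 2)))
        have h3 := min_le_left ((1 - t) / 2) (e * (t / 2))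
        have h4 := min_le_right ((1 - t) / 2) (e * (t / 2))
        have h5 : 0 < min (t / 4) (min ((1 - t) / 2) (e * (t / 2))) := by
          have : 0 < 1 - t := by linarith
          positivity
        generalize min (t / 4) (min ((1 - t) / 2) (e * (t / 2))) = d at *
      · nlinarith
      · nlinarith
      · nlinarith
    have hr : 0 < (1 + d) * t - d * s := by linarith
    refine ⟨d, hd, _, hr, hd2, _, h (d * s / ((1 + d) * t - d * s)) (by positivity) ?_, ?_⟩
    · rw [div_le_iff₀ hr]
      nlinarith
    · generalize hrr : (1 + d) * t - d * s = r at *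
      have : t = (r + d * s) / (1 + d) := by field_simp; linarith
      have h1d : 1 + d ≠ 0 := by positivity
      subst this
      match_scalars <;> field_simp <;> ring

lemma eu_ocone [FiniteDimensional ℝ E] (p : E) {C : Set E} (hC : RO C) (hne : C.Nonempty)
    (l : E →ₗ[ℝ] ℝ) (M : ℝ) (hM : ∀ y ∈ C, l y = M) (hp : l p < M) :
    eu (ocone p C) = - eu C := by
  have hI : l '' (ocone p C) = Ioo (l p) M := by
    ext s
    constructor
    · rintro ⟨_, ⟨t, ht, ht1, y, hy, rfl⟩, rfl⟩
      simp only [map_add, map_smul, map_sub, smul_eq_mul, hM y hy]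
      constructor <;> nlinarith
    · rintro ⟨h1, h2⟩
      obtain ⟨y, hy⟩ := hne
      have h0 : 0 < M - l p := by linarith
      refine ⟨_, ⟨(s - l p) / (M - l p), div_pos (by linarith) h0,
        (div_lt_one h0).2 (by linarith), y, hy, rfl⟩, ?_⟩
      simp only [map_add, map_smul, map_sub, smul_eq_mul, hM y hy]
      field_simp
      ring
  have hIne : (l '' (ocone p C)).Nonempty := by rw [hI]; exact nonempty_Ioo.2 hp
  have heI : eu (l '' (ocone p C)) = -1 := by
    have : vectorSpan ℝ (l '' (ocone p C)) = ⊤ := by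
      rw [hI, ← direction_affineSpan]
      have : affineSpan ℝ (Ioo (l p) M) = ⊤ :=
        IsOpen.affineSpan_eq_top isOpen_Ioo (nonempty_Ioo.2 hp)
      rw [this, AffineSubspace.direction_top]
    rw [eu, if_pos hIne, this, finrank_top]; simp
  have h1 := eu_slice (ocone_ro p hC) l ((l p + M) / 2)
  have hmem : (l p + M) / 2 ∈ l '' (ocone p C) := by
    rw [hI]; constructor <;> linarith
  rw [heI, ind, if_pos hmem] at h1
  have h2 : ocone p C ∩ {x | l x = (l p + M) / 2} = AffineMap.homothety p (1 / 2 : ℝ) '' C := by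
    ext x
    constructor
    · rintro ⟨⟨t, ht, ht1, y, hy, rfl⟩, hx⟩
      simp only [mem_ofPred_eq, map_add, map_smul, map_sub, smul_eq_mul, hM y hy] at hx
      have : t = 1 / 2 := by
        have h0 : M - l p ≠ 0 := by linarith
        apply mul_right_cancel₀ h0; linarith
      refine ⟨y, hy, ?_⟩
      rw [AffineMap.homothety_apply, this]
      simp [add_comm]
    · rintro ⟨y, hy, rfl⟩
      rw [AffineMap.homothety_apply]
      refine ⟨⟨1 / 2, by norm_num, by norm_num, y, hy, by simp [add_comm]⟩, ?_⟩
      simp only [mem_ofPred_eq, vadd_eq_add, vsub_eq_sub, map_add, map_smul, map_sub, smul_eq_mul, hM y hy]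
      ring
  have h3 : eu (AffineMap.homothety p (1 / 2 : ℝ) '' C) = eu C := by
    rw [eu, eu, if_pos hne, if_pos (hne.image _), ← AffineMap.map_vectorSpan,
      AffineMap.homothety_linear, Submodule.map_smul _ _ _ (by norm_num), Submodule.map_id]
  rw [h2, h3] at h1
  linarith

end RelInt

section Faces

variable {n : ℕ}

lemma cone_H (U : Finset (EuclideanSpace ℝ (Fin n))) :
    ∃ A : Finset (EuclideanSpace ℝ (Fin n) →L[ℝ] ℝ), ∀ y,
      (∃ c : EuclideanSpace ℝ (Fin n) → ℝ, (∀ u ∈ U, 0 ≤ c u) ∧ y = ∑ u ∈ U, c u • u) ↔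
        ∀ f ∈ A, 0 ≤ f y := by
  classical
  induction U using Finset.induction_on with
  | empty =>
    refine ⟨Finset.univ.image (fun i : Fin n => EuclideanSpace.proj i) ∪
      Finset.univ.image (fun i : Fin n => -EuclideanSpace.proj i), fun y => ?_⟩
    constructor
    · rintro ⟨c, -, rfl⟩
      simp
    · intro h
      refine ⟨0, by simp, ?_⟩
      ext i
      have h1 := h (EuclideanSpace.proj i) (by simp)
      have h2 := h (-EuclideanSpace.proj i) (by simp)
      simp at h1 h2
      simp
      linarith
  | insert s U hs ih =>
    obtain ⟨A, hA⟩ := ih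
    refine ⟨A.filter (fun f => 0 ≤ f s) ∪
      Finset.image₂ (fun f g => f s • g - g s • f) (A.filter (fun f => 0 ≤ f s))
        (A.filter (fun g => g s < 0)), fun y => ?_⟩
    have step : (∃ c : EuclideanSpace ℝ (Fin n) → ℝ, (∀ u ∈ insert s U, 0 ≤ c u) ∧
        y = ∑ u ∈ insert s U, c u • u) ↔ ∃ t : ℝ, 0 ≤ t ∧ ∀ f ∈ A, 0 ≤ f (y - t • s) := by
      constructor
      · rintro ⟨c, hc, hy⟩
        refine ⟨c s, hc s (by simp), (hA _).1 ⟨c, fun u hu => hc u (by simp [hu]), ?_⟩⟩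
        rw [hy, Finset.sum_insert hs]; simp
      · rintro ⟨t, ht, h⟩
        obtain ⟨c, hc, hy⟩ := (hA _).2 h
        refine ⟨Function.update c s t, ?_, ?_⟩
        · intro u hu
          by_cases hus : u = s
          · simp [hus, ht]
          · simpa [hus] using hc u (by simpa [hus] using hu)
        · rw [Finset.sum_insert hs]
          have : ∑ u ∈ U, Function.update c s t u • u = ∑ u ∈ U, c u • u := by
            refine Finset.sum_congr rfl fun u hu => ?_
            have : u ≠ s := fun h => hs (h ▸ hu)
            simp [this]
          rw [this, ← hy]; simp
    rw [step]
    constructor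
    · rintro ⟨t, ht, h⟩ f hf
      rw [Finset.mem_union] at hf
      rcases hf with hf | hf
      · rw [Finset.mem_filter] at hf
        have := h f hf.1
        simp only [map_sub, map_smul, smul_eq_mul] at this
        nlinarith [mul_nonneg ht hf.2]
      · rw [Finset.mem_image₂] at hf
        obtain ⟨f, hf, g, hg, rfl⟩ := hf
        rw [Finset.mem_filter] at hf hg
        have h1 := h f hf.1
        have h2 := h g hg.1
        simp only [map_sub, map_smul, smul_eq_mul] at h1 h2
        simp only [sub_apply, smul_apply, smul_eq_mul]
        nlinarith [mul_nonneg hf.2 h2, mul_nonneg (neg_nonneg.2 hg.2.le) h1]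
    · intro h
      have h1 : ∀ f ∈ A, 0 ≤ f s → 0 ≤ f y := fun f hf hfs =>
        h f (Finset.mem_union_left _ (Finset.mem_filter.2 ⟨hf, hfs⟩))
      have h2 : ∀ f ∈ A, 0 ≤ f s → ∀ g ∈ A, g s < 0 → 0 ≤ f s * g y - g s * f y := by
        intro f hf hfs g hg hgs
        have := h (f s • g - g s • f) (Finset.mem_union_right _ (Finset.mem_image₂.2
          ⟨f, Finset.mem_filter.2 ⟨hf, hfs⟩, g, Finset.mem_filter.2 ⟨hg, hgs⟩, rfl⟩))
        simpa using this
      obtain ⟨t, htL, ht⟩ := Finset.exists_max_image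
        (insert (0 : ℝ) ((A.filter (fun g => g s < 0)).image (fun g => g y / g s))) id
        (Finset.insert_nonempty _ _)
      simp only [id] at ht
      refine ⟨t, ht 0 (by simp), fun f hf => ?_⟩
      simp only [map_sub, map_smul, smul_eq_mul, sub_nonneg]
      rcases lt_or_ge (f s) 0 with hfs | hfs
      · have := ht (f y / f s) (Finset.mem_insert_of_mem (Finset.mem_image.2
          ⟨f, Finset.mem_filter.2 ⟨hf, hfs⟩, rfl⟩))
        rwa [div_le_iff_of_neg hfs] at this
      · rw [Finset.mem_insert, Finset.mem_image] at htL
        rcases htL with rfl | ⟨g, hg, rfl⟩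
        · simpa using h1 f hf hfs
        · rw [Finset.mem_filter] at hg
          have := h2 f hf hfs g hg.1 hg.2
          rw [div_mul_eq_mul_div, div_le_iff_of_neg hg.2]
          nlinarith

lemma exists_face (S : Finset (EuclideanSpace ℝ (Fin n))) {x : EuclideanSpace ℝ (Fin n)}
    (hx : x ∈ convexHull ℝ (S : Set (EuclideanSpace ℝ (Fin n)))) :
    ∃ F, IsExposed ℝ (convexHull ℝ (S : Set (EuclideanSpace ℝ (Fin n)))) F ∧ x ∈ ri F := by
  classical
  set P := convexHull ℝ (S : Set (EuclideanSpace ℝ (Fin n))) with hP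
  obtain ⟨A, hA⟩ := cone_H (S.image (fun s => s - x))
  have hfS : ∀ f ∈ A, ∀ s ∈ S, f x ≤ f s := by
    intro f hf s hs
    have := (hA (s - x)).1 ⟨fun u => if u = s - x then 1 else 0, fun u _ => by dsimp only; split_ifs <;> simp, by
      simp only [ite_smul, one_smul, zero_smul]
      rw [Finset.sum_ite_eq', if_pos (Finset.mem_image_of_mem _ hs)]⟩ f hf
    simpa using this
  have hfP : ∀ f ∈ A, ∀ y ∈ P, f x ≤ f y := by
    intro f hf y hy
    have : P ⊆ {y | f x ≤ f y} :=
      convexHull_min (fun s hs => hfS f hf s hs) (convex_halfSpace_ge f.isLinear _)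
    exact this hy
  let l : EuclideanSpace ℝ (Fin n) →L[ℝ] ℝ := -∑ f ∈ A, f
  have hl : ∀ z, l z = -∑ f ∈ A, f z := fun z => by simp [l]
  have hlx : ∀ y ∈ P, l y ≤ l x := by
    intro y hy
    rw [hl, hl, neg_le_neg_iff]
    exact Finset.sum_le_sum fun f hf => hfP f hf y hy
  refine ⟨{z ∈ P | ∀ y ∈ P, l y ≤ l z}, fun _ => ⟨l, rfl⟩, ⟨hx, hlx⟩, ?_⟩
  rintro y ⟨hy, hyl⟩
  have heq : l y = l x := le_antisymm (hlx y hy) (hyl x hx)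
  have hf0 : ∀ f ∈ A, f y - f x = 0 := by
    rw [← Finset.sum_eq_zero_iff_of_nonneg (fun f hf => sub_nonneg.2 (hfP f hf y hy)),
      Finset.sum_sub_distrib]
    rw [hl, hl] at heq
    linarith
  obtain ⟨c, hc, hxy⟩ := (hA (x - y)).2 (fun f hf => by
    have := hf0 f hf
    rw [map_sub]; linarith)
  rw [Finset.sum_image (fun a _ b _ h => by simpa using h)] at hxy
  have hc' : ∀ s ∈ S, 0 ≤ c (s - x) := fun s hs => hc _ (Finset.mem_image_of_mem _ hs)
  have hσ : 0 ≤ ∑ s ∈ S, c (s - x) := Finset.sum_nonneg hc'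
  obtain ⟨σ, hσ'⟩ : ∃ σ, σ = ∑ s ∈ S, c (s - x) := ⟨_, rfl⟩
  rw [← hσ'] at hσ
  obtain ⟨w, hw, hw1, hwx⟩ := Finset.mem_convexHull'.1 hx
  have he : 0 < 1 / (1 + σ) := by positivity
  refine ⟨1 / (1 + σ), he, ?_, ?_⟩
  · rw [hP, Finset.mem_convexHull']
    refine ⟨fun s => (1 - 1 / (1 + σ) * σ) * w s + 1 / (1 + σ) * c (s - x), ?_, ?_, ?_⟩
    · intro s hs
      have h1 : 1 - 1 / (1 + σ) * σ = 1 / (1 + σ) := by field_simp; ring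
      have := hw s hs
      have := hc' s hs
      simp only [h1]
      positivity
    · rw [Finset.sum_add_distrib, ← Finset.mul_sum, ← Finset.mul_sum, hw1, ← hσ']; ring
    · rw [hxy]
      simp only [add_smul, mul_smul, Finset.sum_add_distrib, ← Finset.smul_sum, hwx, smul_sub,
        Finset.sum_sub_distrib, ← Finset.sum_smul, ← hσ']
      module
  · intro z hz
    have : l (x + (1 / (1 + σ)) • (x - y)) = l x := by simp [heq]
    rw [this]; exact hlx z hz

lemma face_eq (S : Finset (EuclideanSpace ℝ (Fin n))) {F : Set (EuclideanSpace ℝ (Fin n))}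
    (hF : IsExposed ℝ (convexHull ℝ (S : Set (EuclideanSpace ℝ (Fin n)))) F) (hne : F.Nonempty) :
    ∃ T ⊆ S, T.Nonempty ∧ F = convexHull ℝ (T : Set (EuclideanSpace ℝ (Fin n))) := by
  classical
  have hconv : Convex ℝ F := hF.convex (convex_convexHull ℝ _)
  have key : F = convexHull ℝ ((S.filter (· ∈ F) : Finset _) : Set (EuclideanSpace ℝ (Fin n))) := by
    apply Subset.antisymm
    · intro y hy
      obtain ⟨l, hl⟩ := hF hne
      obtain ⟨w, hw, hw1, hwy⟩ := Finset.mem_convexHull'.1 (hF.subset hy)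
      have hmax : ∀ z ∈ convexHull ℝ (S : Set (EuclideanSpace ℝ (Fin n))), l z ≤ l y := by
        rw [hl] at hy; exact hy.2
      have h0 : ∑ s ∈ S, w s * (l y - l s) = 0 := by
        simp only [mul_sub, Finset.sum_sub_distrib, ← Finset.sum_mul, hw1]
        have : l y = ∑ s ∈ S, w s * l s := by rw [← hwy]; simp
        linarith
      rw [Finset.sum_eq_zero_iff_of_nonneg (fun s hs => mul_nonneg (hw s hs)
        (sub_nonneg.2 (hmax s (subset_convexHull ℝ _ hs))))] at h0
      have h1 : ∀ s ∈ S, w s ≠ 0 → s ∈ F := by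
        intro s hs hws
        have := (mul_eq_zero.1 (h0 s hs)).resolve_left hws
        rw [hl]
        refine ⟨subset_convexHull ℝ _ hs, fun z hz => ?_⟩
        linarith [hmax z hz]
      rw [Finset.mem_convexHull']
      refine ⟨w, fun s hs => hw s (Finset.mem_filter.1 hs).1, ?_, ?_⟩
      · rw [← hw1]
        exact Finset.sum_filter_of_ne h1
      · rw [← hwy]
        refine Finset.sum_filter_of_ne (fun s hs h => h1 s hs ?_)
        rintro h'; simp [h'] at h
    · exact convexHull_min (fun s hs => (Finset.mem_filter.1 hs).2) hconv
  refine ⟨S.filter (· ∈ F), Finset.filter_subset _ _, ?_, key⟩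
  rw [key, convexHull_nonempty_iff] at hne
  exact_mod_cast hne

lemma face_sub {P F G : Set (EuclideanSpace ℝ (Fin n))} (hF : IsExposed ℝ P F) (hG : G ⊆ P)
    {x : EuclideanSpace ℝ (Fin n)} (hx : x ∈ F) (hxG : x ∈ ri G) : G ⊆ F := by
  intro y hy
  obtain ⟨l, hl⟩ := hF ⟨x, hx⟩
  obtain ⟨e, he, h⟩ := hxG.2 y hy
  rw [hl] at hx ⊢
  have h1 := hx.2 _ (hG h)
  simp only [map_add, map_smul, map_sub, smul_eq_mul] at h1
  have h2 : l x ≤ l y := by nlinarith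
  exact ⟨hG hy, fun z hz => (hx.2 z hz).trans h2⟩

lemma exists_exit {P : Set (EuclideanSpace ℝ (Fin n))} (hP : IsCompact P)
    {p x : EuclideanSpace ℝ (Fin n)} (hx : x ∈ P) (hxp : x ≠ p) :
    ∃ t : ℝ, 1 ≤ t ∧ p + t • (x - p) ∈ P ∧ ∀ s, p + s • (x - p) ∈ P → s ≤ t := by
  obtain ⟨R, hR⟩ := hP.isBounded.exists_norm_le
  have hn : 0 < ‖x - p‖ := norm_pos_iff.2 (sub_ne_zero.2 hxp)
  have hbd : ∀ s, p + s • (x - p) ∈ P → s ≤ (R + ‖p‖) / ‖x - p‖ := by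
    intro s hs
    rw [le_div_iff₀ hn]
    calc s * ‖x - p‖ ≤ |s| * ‖x - p‖ := by gcongr; exact le_abs_self s
      _ = ‖(p + s • (x - p)) - p‖ := by rw [add_sub_cancel_left, norm_smul, Real.norm_eq_abs]
      _ ≤ ‖p + s • (x - p)‖ + ‖p‖ := norm_sub_le _ _
      _ ≤ R + ‖p‖ := by gcongr; exact hR _ hs
  have h1 : p + (1 : ℝ) • (x - p) ∈ P := by simpa using hx
  have hcpt : IsCompact (Icc 1 ((R + ‖p‖) / ‖x - p‖) ∩ (fun s : ℝ => p + s • (x - p)) ⁻¹' P) :=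
    isCompact_Icc.inter_right (hP.isClosed.preimage (by fun_prop))
  obtain ⟨t, ht, hmax⟩ := hcpt.exists_isGreatest ⟨1, ⟨le_rfl, hbd 1 h1⟩, h1⟩
  refine ⟨t, ht.1.1, ht.2, fun s hs => ?_⟩
  rcases le_total s 1 with h | h
  · exact h.trans ht.1.1
  · exact hmax ⟨⟨h, hbd s hs⟩, hs⟩

lemma euler_main (S : Finset (EuclideanSpace ℝ (Fin n))) (hS : S.Nonempty)
    (P : Set (EuclideanSpace ℝ (Fin n))) (hP : P = convexHull ℝ (S : Set (EuclideanSpace ℝ (Fin n))))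
    (Fs : Finset (Set (EuclideanSpace ℝ (Fin n))))
    (hFs : ∀ F, F ∈ Fs ↔ IsExposed ℝ P F ∧ F.Nonempty) :
    ∑ F ∈ Fs, (-1 : ℤ) ^ finrank ℝ (vectorSpan ℝ F) = 1 := by
  classical
  have hPconv : Convex ℝ P := hP ▸ convex_convexHull ℝ _
  have hPcpt : IsCompact P := hP ▸ S.finite_toSet.isCompact_convexHull ℝ
  obtain ⟨p, hp⟩ : (ri P).Nonempty := hP ▸ ri_convexHull_nonempty S hS
  have hPF : P ∈ Fs := (hFs P).2 ⟨IsExposed.refl P, p, hp.1⟩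
  have hFri : ∀ F ∈ Fs, (ri F).Nonempty := by
    intro F hF
    obtain ⟨h1, h2⟩ := (hFs F).1 hF
    obtain ⟨T, -, hT, rfl⟩ := face_eq S (hP ▸ h1) h2
    exact ri_convexHull_nonempty T hT
  have hFconv : ∀ F ∈ Fs, Convex ℝ F := fun F hF => ((hFs F).1 hF).1.convex hPconv
  have hFsub : ∀ F ∈ Fs, F ⊆ P := fun F hF => ((hFs F).1 hF).1.subset
  have huniq : ∀ F ∈ Fs, ∀ G ∈ Fs, ∀ x, x ∈ ri F → x ∈ ri G → F = G := by
    intro F hF G hG x h1 h2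
    exact Subset.antisymm (face_sub ((hFs G).1 hG).1 (hFsub F hF) h2.1 h1)
      (face_sub ((hFs F).1 hF).1 (hFsub G hG) h1.1 h2)
  have hin : ∀ y ∈ P, ∀ t : ℝ, 0 < t → t < 1 → p + t • (y - p) ∈ ri P := by
    intro y hy t ht ht1
    have := ri_seg hPconv hp hy (t := 1 - t) (by linarith) (by linarith)
    convert this using 1
    module
  have hcone_sub : ∀ F ∈ Fs, ocone p (ri F) ⊆ ri P := by
    rintro F hF _ ⟨t, ht, ht1, y, hy, rfl⟩
    exact hin y (hFsub F hF hy.1) t ht ht1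
  have hpcone : ∀ F ∈ Fs.erase P, p ∉ ocone p (ri F) := by
    rintro F hF ⟨t, ht, ht1, y, hy, h⟩
    rw [Finset.mem_erase] at hF
    have h0 : t • (y - p) = 0 := by simpa using h.symm
    have : y = p := sub_eq_zero.1 ((smul_eq_zero.1 h0).resolve_left ht.ne')
    exact hF.1 (huniq F hF.2 P hPF p (this ▸ hy) hp)
  have hex : ∀ x ∈ ri P, x ≠ p → ∃ F ∈ Fs.erase P, x ∈ ocone p (ri F) := by
    intro x hx hxp
    obtain ⟨t, ht1, ht, hmax⟩ := exists_exit hPcpt hx.1 hxp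
    have ht1' : 1 < t := by
      obtain ⟨e, he, h⟩ := hx.2 p hp.1
      have := hmax (1 + e) (by convert h using 1; module)
      linarith
    obtain ⟨F, hF, hyF⟩ := exists_face S (hP ▸ ht)
    rw [← hP] at hF
    have hFm : F ∈ Fs := (hFs F).2 ⟨hF, _, hyF.1⟩
    refine ⟨F, Finset.mem_erase.2 ⟨?_, hFm⟩, 1 / t, by positivity,
      (div_lt_one (by positivity)).2 ht1', _, hyF, ?_⟩
    · rintro rfl
      obtain ⟨e, he, h⟩ := hyF.2 p hp.1
      have := hmax (t + e * t) (by convert h using 1; module)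
      nlinarith
    · have : t ≠ 0 := by positivity
      simp [smul_smul, this]
  have hun : ∀ x, ∀ F ∈ Fs.erase P, ∀ G ∈ Fs.erase P, x ∈ ocone p (ri F) → x ∈ ocone p (ri G) →
      F = G := by
    have aux : ∀ (y z : EuclideanSpace ℝ (Fin n)) (t s : ℝ), 0 < t → 0 < s → z ∈ P →
        p + t • (y - p) = p + s • (z - p) → s < t → y ∈ ri P := by
      intro y z t s ht hs hz h hst
      have := hin z hz (s / t) (by positivity) ((div_lt_one ht).2 hst)
      convert this using 1
      have h' : t • (y - p) = s • (z - p) := by simpa using h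
      have h2 : y - p = (s / t) • (z - p) := by
        rw [div_eq_inv_mul, mul_smul, ← h', smul_smul, inv_mul_cancel₀ ht.ne', one_smul]
      rw [← h2]; simp
    rintro x F hF G hG ⟨t, ht, ht1, y, hy, rfl⟩ ⟨s, hs, hs1, z, hz, h⟩
    rw [Finset.mem_erase] at hF hG
    rcases lt_trichotomy s t with hst | rfl | hst
    · exact absurd (huniq F hF.2 P hPF y hy
        (aux y z t s ht hs (hFsub G hG.2 hz.1) h hst)) hF.1
    · have h' : s • (y - p) = s • (z - p) := by simpa using h
      have : y = z := by simpa using smul_right_injective _ hs.ne' h'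
      exact huniq F hF.2 G hG.2 y hy (this ▸ hz)
    · exact absurd (huniq G hG.2 P hPF z hz
        (aux z y s t hs ht (hFsub F hF.2 hy.1) h.symm hst)) hG.1
  have hind : ∀ x, ind (ri P) x = ind {p} x + ∑ F ∈ Fs.erase P, ind (ocone p (ri F)) x := by
    intro x
    by_cases hxp : x = p
    · subst hxp
      rw [Finset.sum_eq_zero (fun F hF => by rw [ind, if_neg (hpcone F hF)])]
      simp [ind, hp]
    · by_cases hx : x ∈ ri P
      · obtain ⟨F, hF, hxF⟩ := hex x hx hxp
        rw [Finset.sum_eq_single_of_mem F hF (fun G hG hGF => by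
          rw [ind, if_neg (fun h => hGF (hun x G hG F hF h hxF))])]
        simp [ind, hx, hxp, hxF]
      · rw [Finset.sum_eq_zero (fun F hF => by
          rw [ind, if_neg (fun h => hx (hcone_sub F (Finset.mem_of_mem_erase hF) h))])]
        simp [ind, hx, hxp]
  obtain ⟨R, hR⟩ := hPcpt.isBounded.exists_norm_le
  let C : Option (Option {F // F ∈ Fs.erase P}) → Set (EuclideanSpace ℝ (Fin n)) := fun o =>
    match o with
    | none => ri P
    | some none => {p}
    | some (some F) => ocone p (ri F.1)
  let a : Option (Option {F // F ∈ Fs.erase P}) → ℤ := fun o =>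
    match o with
    | none => 1
    | some _ => -1
  have hCP : ∀ i, C i ⊆ P := by
    rintro (_ | _ | F)
    · exact ri_subset P
    · simpa [C] using hp.1
    · exact (hcone_sub F.1 (Finset.mem_of_mem_erase F.2)).trans (ri_subset P)
  have hV := val a (-R) C (by
      rintro (_ | _ | F)
      · exact ri_ro hPconv
      · refine ⟨convex_singleton p, ?_⟩
        intro x hx y hy
        have hx' : x = p := hx
        have hy' : y = p := hy
        exact ⟨1, one_pos, by simp [C, hx', hy']⟩
      · exact ocone_ro p (ri_ro (hFconv _ (Finset.mem_of_mem_erase F.2))))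
    (by
      intro i x hx j
      have h1 := hR x (hCP i hx)
      have h2 := PiLp.norm_apply_le x j
      rw [Real.norm_eq_abs] at h2
      linarith [neg_abs_le (x j)])
    (by
      intro x
      rw [Fintype.sum_option, Fintype.sum_option]
      simp only [a, C]
      rw [hind x, ← Finset.mul_sum,
        Finset.sum_coe_sort (Fs.erase P) (fun F => ind (ocone p (ri F)) x)]
      ring)
  rw [Fintype.sum_option, Fintype.sum_option] at hV
  simp only [a, C] at hV
  rw [← Finset.mul_sum, Finset.sum_coe_sort (Fs.erase P) (fun F => eu (ocone p (ri F))),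
    eu_singleton, eu_ri hPconv ⟨p, hp⟩] at hV
  have hsum : ∑ F ∈ Fs.erase P, eu (ocone p (ri F)) =
      - ∑ F ∈ Fs.erase P, (-1 : ℤ) ^ finrank ℝ (vectorSpan ℝ F) := by
    rw [← Finset.sum_neg_distrib]
    refine Finset.sum_congr rfl fun F hF => ?_
    rw [Finset.mem_erase] at hF
    obtain ⟨hFe, hFne⟩ := (hFs F).1 hF.2
    obtain ⟨l, hl⟩ := hFe hFne
    obtain ⟨y0, hy0⟩ := hFne
    have hmax : ∀ y ∈ F, ∀ z ∈ P, l z ≤ l y := fun y hy => by rw [hl] at hy; exact hy.2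
    rw [← eu_ri (hFconv F hF.2) (hFri F hF.2)]
    refine eu_ocone p (ri_ro (hFconv F hF.2)) (hFri F hF.2) l.toLinearMap (l y0) ?_ ?_
    · intro y hy
      exact le_antisymm (hmax y0 hy0 y (hFsub F hF.2 hy.1)) (hmax y hy.1 y0 (hFsub F hF.2 hy0))
    · by_contra hcon
      have hcon' : l y0 ≤ l p := not_lt.1 hcon
      have hpF : p ∈ F := by
        rw [hl]; exact ⟨hp.1, fun z hz => (hmax y0 hy0 z hz).trans hcon'⟩
      exact hF.1 (Subset.antisymm (hFsub F hF.2) (face_sub hFe Subset.rfl hpF hp))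
  rw [hsum] at hV
  rw [← Finset.add_sum_erase Fs _ hPF]
  linarith

end Faces

/-- Inductive step (Lemma 2): if the Euler–Poincaré relation holds for all convex
polytopes of dimensions k-1 and k (k ≥ 2), it holds for any polytope of dimension k+1. -/
theorem euler_poincare_inductive_step {n k : ℕ} (hk : 2 ≤ k)
    (P : Set (EuclideanSpace ℝ (Fin n))) (hP : IsPolytope P) (hd : pdim P = k + 1)
    (ih : ∀ m : ℕ, (m = k - 1 ∨ m = k) → ∀ N : ℕ, ∀ Q : Set (EuclideanSpace ℝ (Fin N)),
      IsPolytope Q → pdim Q = m →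
      ∑ c ∈ Finset.range (m + 1), (-1 : ℤ) ^ c * (fc Q c : ℤ) = 1) :
    ∑ c ∈ Finset.range (k + 2), (-1 : ℤ) ^ c * (fc P c : ℤ) = 1 := by
  classical
  obtain ⟨S, hS, hPS⟩ := hP
  have hfin : {F | IsExposed ℝ P F ∧ F.Nonempty}.Finite := by
    refine (S.powerset.finite_toSet.image
      (fun T : Finset (EuclideanSpace ℝ (Fin n)) => convexHull ℝ (T : Set (EuclideanSpace ℝ (Fin n))))).subset ?_
    rintro F ⟨hF, hne⟩
    obtain ⟨T, hTS, -, rfl⟩ := face_eq S (hPS ▸ hF) hne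
    exact ⟨T, by simpa using hTS, rfl⟩
  have hmem : ∀ F, F ∈ hfin.toFinset ↔ IsExposed ℝ P F ∧ F.Nonempty := fun F => by simp
  have hdim : ∀ F : Set (EuclideanSpace ℝ (Fin n)), pdim F = finrank ℝ (vectorSpan ℝ F) := fun F => by
    rw [pdim, direction_affineSpan]
  refine Eq.trans ?_ (euler_main S hS P hPS hfin.toFinset hmem)
  rw [← Finset.sum_fiberwise_of_maps_to (g := pdim) (t := Finset.range (k + 2))]
  · refine Finset.sum_congr rfl fun c _ => ?_
    have h1 : {F | IsFaceDim P F c} = ((hfin.toFinset.filter (fun F => pdim F = c) : Finset _) : Set _) := by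
      ext F
      simp [IsFaceDim, and_assoc]
    have h2 : ∀ F ∈ hfin.toFinset.filter (fun F => pdim F = c),
        (-1 : ℤ) ^ finrank ℝ (vectorSpan ℝ F) = (-1 : ℤ) ^ c := by
      intro F hF
      rw [← hdim, (Finset.mem_filter.1 hF).2]
    rw [fc, h1, Set.ncard_coe_finset]
    refine Eq.trans ?_ (Finset.sum_congr rfl h2).symm
    rw [Finset.sum_const, nsmul_eq_mul, mul_comm]
  · intro F hF
    rw [Finset.mem_range]
    have : pdim F ≤ pdim P := by
      rw [hdim, hdim]
      exact Submodule.finrank_mono (vectorSpan_mono ℝ ((hmem F).1 hF).1.subset)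
    omega
end

section
/- For every convex polytope P of dimension d ≥ 1 in ℝ^n, the alternating sum of face numbers satisfies ∑_{c=0}^{d} (-1)^c f^c(P) = 1, where f^c(P) is the number of faces of P of dimension c (with f^d = 1 counting P itself). -/
open Set

namespace EulerAux

open Filter Topology

/-- Algebraic form of Farkas' lemma. -/
theorem farkas {ι : Type*} {n : ℕ} (s : Finset ι) :
    ∀ (v : ι → EuclideanSpace ℝ (Fin n)) (b : EuclideanSpace ℝ (Fin n)),
    (∃ c : ι → ℝ, (∀ i ∈ s, 0 ≤ c i) ∧ b = ∑ i ∈ s, c i • v i) ∨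
    ∃ l : EuclideanSpace ℝ (Fin n) →L[ℝ] ℝ, (∀ i ∈ s, 0 ≤ l (v i)) ∧ l b < 0 := by
  classical
  induction s using Finset.induction_on with
  | empty =>
    intro v b
    by_cases hb : b = 0
    · left; exact ⟨0, by simp, by simp [hb]⟩
    · right
      refine ⟨-innerSL ℝ b, by simp, ?_⟩
      have : 0 < inner ℝ b b := by
        rw [real_inner_self_eq_norm_sq]; positivity
      simpa using this
  | insert a s ha ih =>
    intro v b
    rcases ih v b with ⟨c, hc, hb⟩ | ⟨l, hl, hlb⟩
    · left
      refine ⟨fun i => if i = a then 0 else c i, ?_, ?_⟩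
      · intro i hi
        by_cases h : i = a
        · simp [h]
        · simpa [h] using hc i (by simpa [h] using hi)
      · rw [Finset.sum_insert ha, hb]
        simp only [if_true, zero_smul, zero_add]
        refine Finset.sum_congr rfl fun i hi => ?_
        have : i ≠ a := fun h => ha (h ▸ hi)
        simp [this]
    · by_cases h0 : 0 ≤ l (v a)
      · right
        refine ⟨l, ?_, hlb⟩
        intro i hi
        rcases Finset.mem_insert.1 hi with rfl | hi
        · exact h0
        · exact hl i hi
      push Not at h0
      rcases ih (fun i => v i - (l (v i) / l (v a)) • v a) (b - (l b / l (v a)) • v a) with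
        ⟨c, hc, hb⟩ | ⟨m, hm, hmb⟩
      · left
        refine ⟨fun i => if i = a then l b / l (v a) - ∑ i ∈ s, c i * (l (v i) / l (v a)) else c i,
          ?_, ?_⟩
        · intro i hi
          by_cases h : i = a
          · have h1 : 0 ≤ l b / l (v a) := div_nonneg_of_nonpos hlb.le h0.le
            have h2 : ∑ i ∈ s, c i * (l (v i) / l (v a)) ≤ 0 :=
              Finset.sum_nonpos fun i hi => mul_nonpos_of_nonneg_of_nonpos (hc i hi)
                (div_nonpos_of_nonneg_of_nonpos (hl i hi) h0.le)
            simp only [h, if_true]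
            linarith
          · simpa [h] using hc i (by simpa [h] using hi)
        · rw [Finset.sum_insert ha]
          have e : ∑ x ∈ s, (if x = a then l b / l (v a) - ∑ i ∈ s, c i * (l (v i) / l (v a))
              else c x) • v x = ∑ x ∈ s, c x • v x := by
            refine Finset.sum_congr rfl fun i hi => ?_
            have : i ≠ a := fun h => ha (h ▸ hi)
            simp [this]
          rw [e]
          simp only [if_true]
          rw [sub_eq_iff_eq_add] at hb
          generalize l b / l (v a) = q at hb ⊢
          rw [hb]
          simp only [smul_sub, Finset.sum_sub_distrib, sub_smul, Finset.sum_smul, smul_smul]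
          abel
      · right
        refine ⟨m - (m (v a) / l (v a)) • l, ?_, ?_⟩
        · intro i hi
          rcases Finset.mem_insert.1 hi with rfl | hi
          · simp [div_mul_cancel₀ _ h0.ne]
          · have := hm i hi
            simp only [map_sub, map_smul, smul_eq_mul, _root_.sub_apply, 
              _root_.smul_apply] at this ⊢
            convert this using 1
            ring
        · simp only [map_sub, map_smul, smul_eq_mul, _root_.sub_apply, 
              _root_.smul_apply] at hmb ⊢
          convert hmb using 1
          ring

/-- Relatively open convex sets, defined algebraically. -/
def RelOpen {n : ℕ} (A : Set (EuclideanSpace ℝ (Fin n))) : Prop :=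
  Convex ℝ A ∧ ∀ x ∈ A, ∀ y ∈ A, ∃ ε > (0 : ℝ), x + ε • (x - y) ∈ A

open Classical in
/-- Euler characteristic of a relatively open convex set. -/
noncomputable def chi {n : ℕ} (A : Set (EuclideanSpace ℝ (Fin n))) : ℤ :=
  if A.Nonempty then (-1) ^ pdim A else 0

/-- Slice of a set by a level set of a functional. -/
def slice {n : ℕ} (A : Set (EuclideanSpace ℝ (Fin n))) (l : EuclideanSpace ℝ (Fin n) →L[ℝ] ℝ)
    (t : ℝ) : Set (EuclideanSpace ℝ (Fin n)) := {x | x ∈ A ∧ l x = t}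

variable {n : ℕ}

theorem slice_relOpen {A : Set (EuclideanSpace ℝ (Fin n))} (hA : RelOpen A)
    (l : EuclideanSpace ℝ (Fin n) →L[ℝ] ℝ) (t : ℝ) : RelOpen (slice A l t) := by
  refine ⟨?_, ?_⟩
  · intro x hx y hy a b ha hb hab
    refine ⟨hA.1 hx.1 hy.1 ha hb hab, ?_⟩
    simp [hx.2, hy.2, ← add_mul, hab]
  · intro x hx y hy
    obtain ⟨ε, h, h'⟩ := hA.2 x hx.1 y hy.1
    exact ⟨ε, h, h', by simp [hx.2, hy.2]⟩

theorem shrink {A : Set (EuclideanSpace ℝ (Fin n))} (hA : Convex ℝ A)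
    {x v : EuclideanSpace ℝ (Fin n)} (hx : x ∈ A) {ε δ : ℝ} (hδ : 0 ≤ δ) (h : δ ≤ ε)
    (hv : x + ε • v ∈ A) : x + δ • v ∈ A := by
  rcases hδ.eq_or_lt with rfl | hδ'
  · simpa
  have hε : 0 < ε := by linarith
  have := hA.add_smul_mem hx hv (t := δ / ε) ⟨by positivity, by rwa [div_le_one hε]⟩
  rwa [smul_smul, div_mul_cancel₀ _ hε.ne'] at this

theorem mem_direction {A : Set (EuclideanSpace ℝ (Fin n))} (hA : RelOpen A)
    {x : EuclideanSpace ℝ (Fin n)} (hx : x ∈ A) (v : EuclideanSpace ℝ (Fin n)) :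
    v ∈ (affineSpan ℝ A).direction ↔ ∃ ε > (0 : ℝ), x + ε • v ∈ A := by
  rw [direction_affineSpan]
  constructor
  · let D : Submodule ℝ (EuclideanSpace ℝ (Fin n)) :=
      { carrier := {v | ∃ ε > (0 : ℝ), x + ε • v ∈ A}
        zero_mem' := ⟨1, one_pos, by simpa⟩
        add_mem' := by
          rintro v w ⟨ε, hε, hv⟩ ⟨δ, hδ, hw⟩
          have h : 0 < min ε δ := lt_min hε hδ
          refine ⟨min ε δ / 2, by positivity, ?_⟩
          have := convex_iff_forall_pos.1 hA.1 (shrink hA.1 hx h.le (min_le_left _ _) hv)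
            (shrink hA.1 hx h.le (min_le_right _ _) hw)
            (show (0 : ℝ) < 1 / 2 by norm_num) (show (0 : ℝ) < 1 / 2 by norm_num) (by norm_num)
          convert this using 1
          module
        smul_mem' := by
          have hneg : ∀ v, (∃ ε > (0 : ℝ), x + ε • v ∈ A) → ∃ ε > (0 : ℝ), x + ε • (-v) ∈ A := by
            rintro v ⟨ε, hε, hv⟩
            obtain ⟨δ, hδ, h⟩ := hA.2 x hx _ hv
            refine ⟨δ * ε, by positivity, ?_⟩
            convert h using 1
            module
          have hpos : ∀ c > (0 : ℝ), ∀ v, (∃ ε > (0 : ℝ), x + ε • v ∈ A) → 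
              ∃ ε > (0 : ℝ), x + ε • (c • v) ∈ A := by
            rintro c hc v ⟨ε, hε, hv⟩
            refine ⟨ε / c, by positivity, ?_⟩
            rwa [smul_smul, div_mul_cancel₀ _ hc.ne']
          intro c v hv
          rcases lt_trichotomy c 0 with hc | rfl | hc
          · have := hpos (-c) (by linarith) _ (hneg v hv)
            simpa using this
          · exact ⟨1, one_pos, by simpa⟩
          · exact hpos c hc v hv }
    have : vectorSpan ℝ A ≤ D := by
      rw [vectorSpan_eq_span_vsub_set_right ℝ hx, Submodule.span_le]
      rintro _ ⟨y, hy, rfl⟩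
      exact ⟨1, one_pos, by simpa using hy⟩
    exact fun h => this h
  · rintro ⟨ε, hε, h⟩
    have := vsub_mem_vectorSpan ℝ h hx
    have h2 := (vectorSpan ℝ A).smul_mem ε⁻¹ this
    simpa [smul_smul, inv_mul_cancel₀ hε.ne'] using h2

theorem slice_dim {A : Set (EuclideanSpace ℝ (Fin n))} (hA : RelOpen A)
    (l : EuclideanSpace ℝ (Fin n) →L[ℝ] ℝ) {x y : EuclideanSpace ℝ (Fin n)} (hx : x ∈ A)
    (hy : y ∈ A) (hxy : l y ≠ l x) : pdim A = pdim (slice A l (l x)) + 1 := by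
  have hxs : x ∈ slice A l (l x) := ⟨hx, rfl⟩
  have key : (affineSpan ℝ (slice A l (l x))).direction =
      (affineSpan ℝ A).direction ⊓ LinearMap.ker (l : EuclideanSpace ℝ (Fin n) →ₗ[ℝ] ℝ) := by
    ext v
    rw [mem_direction (slice_relOpen hA l _) hxs, Submodule.mem_inf, mem_direction hA hx]
    constructor
    · rintro ⟨ε, hε, h, h'⟩
      refine ⟨⟨ε, hε, h⟩, ?_⟩
      simpa [hε.ne'] using h'
    · rintro ⟨⟨ε, hε, h⟩, h'⟩
      refine ⟨ε, hε, h, ?_⟩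
      have : l v = 0 := h'
      simp [this]
  unfold pdim
  rw [key]
  set V := (affineSpan ℝ A).direction
  set m : V →ₗ[ℝ] ℝ := (l : EuclideanSpace ℝ (Fin n) →ₗ[ℝ] ℝ).domRestrict V
  have hw : y - x ∈ V := by
    rw [mem_direction hA hx]; exact ⟨1, one_pos, by simpa using hy⟩
  have hm : LinearMap.range m = ⊤ := by
    rw [LinearMap.range_eq_top]
    apply LinearMap.surjective
    intro h
    have : m ⟨y - x, hw⟩ = 0 := by rw [h]; rfl
    have h2 : l y - l x = 0 := by simpa [m] using this
    exact hxy (by linarith)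
  have h1 := LinearMap.finrank_range_add_finrank_ker m
  rw [hm, finrank_top, Module.finrank_self] at h1
  have h2 : Module.finrank ℝ (LinearMap.ker m) = Module.finrank ℝ
      ↥(V ⊓ LinearMap.ker (l : EuclideanSpace ℝ (Fin n) →ₗ[ℝ] ℝ)) := by
    have : LinearMap.ker m = Submodule.comap V.subtype
        (LinearMap.ker (l : EuclideanSpace ℝ (Fin n) →ₗ[ℝ] ℝ)) := by
      ext v; simp [m]
    rw [this, ← Submodule.map_comap_subtype]
    exact (LinearEquiv.finrank_eq (Submodule.equivMapOfInjective V.subtype V.injective_subtype _))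
  omega

theorem chi_empty : chi (∅ : Set (EuclideanSpace ℝ (Fin n))) = 0 := by simp [chi]

theorem ev_Ioo (a b t : ℝ) : ∀ᶠ s in 𝓝[>] t, ((a < s ∧ s < b) ↔ (a ≤ t ∧ t < b)) := by
  have h0 : ∀ᶠ s in 𝓝[>] t, t < s := self_mem_nhdsWithin
  by_cases ha : a ≤ t
  · by_cases hb : t < b
    · have h1 : ∀ᶠ s in 𝓝[>] t, s < b := (eventually_lt_nhds hb).filter_mono nhdsWithin_le_nhds
      filter_upwards [h0, h1] with s h h'
      exact ⟨fun _ => ⟨ha, hb⟩, fun _ => ⟨by linarith, h'⟩⟩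
    · filter_upwards [h0] with s h
      exact ⟨fun h' => absurd (h.trans h'.2) hb, fun h' => absurd h'.2 hb⟩
  · have h1 : ∀ᶠ s in 𝓝[>] t, s < a :=
      (eventually_lt_nhds (not_le.1 ha)).filter_mono nhdsWithin_le_nhds
    filter_upwards [h1] with s h
    exact ⟨fun h' => absurd h'.1 h.not_gt, fun h' => absurd h'.1 ha⟩

theorem ev_Icc (a b t : ℝ) : ∀ᶠ s in 𝓝[>] t, ((a ≤ s ∧ s ≤ b) ↔ (a ≤ t ∧ t < b)) := by
  have h0 : ∀ᶠ s in 𝓝[>] t, t < s := self_mem_nhdsWithin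
  by_cases ha : a ≤ t
  · by_cases hb : t < b
    · have h1 : ∀ᶠ s in 𝓝[>] t, s < b := (eventually_lt_nhds hb).filter_mono nhdsWithin_le_nhds
      filter_upwards [h0, h1] with s h h'
      exact ⟨fun _ => ⟨ha, hb⟩, fun _ => ⟨by linarith, h'.le⟩⟩
    · filter_upwards [h0] with s h
      exact ⟨fun h' => absurd (h.trans_le h'.2) hb, fun h' => absurd h'.2 hb⟩
  · have h1 : ∀ᶠ s in 𝓝[>] t, s < a :=
      (eventually_lt_nhds (not_le.1 ha)).filter_mono nhdsWithin_le_nhds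
    filter_upwards [h1] with s h
    exact ⟨fun h' => absurd h'.1 h.not_ge, fun h' => absurd h'.1 ha⟩

theorem ev_ne (p t : ℝ) : ∀ᶠ s in 𝓝[>] t, s ≠ p := by
  filter_upwards [ev_Icc p p t] with s h hs
  have := h.1 ⟨hs.ge, hs.le⟩
  linarith [this.1, this.2]

theorem image_Ioo {A : Set (EuclideanSpace ℝ (Fin n))} (hA : RelOpen A)
    (l : EuclideanSpace ℝ (Fin n) →L[ℝ] ℝ) (hb : BddAbove (l '' A)) (hb' : BddBelow (l '' A))
    {x y : EuclideanSpace ℝ (Fin n)} (hx : x ∈ A) (hy : y ∈ A) (hxy : l x ≠ l y) :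
    ∃ a b : ℝ, a < b ∧ ∀ t, (∃ z ∈ A, l z = t) ↔ a < t ∧ t < b := by
  have hne : (l '' A).Nonempty := ⟨_, x, hx, rfl⟩
  have hmove : ∀ z ∈ A, ∃ u ∈ A, ∃ v ∈ A, l u < l z ∧ l z < l v := by
    intro z hz
    obtain ⟨w, hw, hwz⟩ : ∃ w ∈ A, l w ≠ l z := by
      by_contra! h
      exact hxy ((h x hx).trans (h y hy).symm)
    obtain ⟨ε, hε, h⟩ := hA.2 z hz w hw
    rcases lt_or_gt_of_ne hwz with h1 | h1
    · refine ⟨w, hw, _, h, h1, ?_⟩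
      have : 0 < ε * (l z - l w) := mul_pos hε (by linarith)
      simpa using this
    · refine ⟨_, h, w, hw, ?_, h1⟩
      have : 0 < ε * (l w - l z) := mul_pos hε (by linarith)
      simp only [map_add, map_smul, map_sub, smul_eq_mul]
      linarith
  have hord : (l '' A).OrdConnected :=
    (hA.1.is_linear_image (l : EuclideanSpace ℝ (Fin n) →ₗ[ℝ] ℝ).isLinear).ordConnected
  have key : ∀ t, (∃ z ∈ A, l z = t) ↔ sInf (l '' A) < t ∧ t < sSup (l '' A) := by
    intro t
    constructor
    · rintro ⟨z, hz, rfl⟩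
      obtain ⟨u, hu, v, hv, h1, h2⟩ := hmove z hz
      exact ⟨(csInf_le hb' ⟨u, hu, rfl⟩).trans_lt h1, h2.trans_le (le_csSup hb ⟨v, hv, rfl⟩)⟩
    · rintro ⟨h1, h2⟩
      obtain ⟨p, hp, hpt⟩ := exists_lt_of_csInf_lt hne h1
      obtain ⟨q, hq, hqt⟩ := exists_lt_of_lt_csSup hne h2
      exact hord.out hp hq ⟨hpt.le, hqt.le⟩
  have := (key (l x)).1 ⟨x, hx, rfl⟩
  exact ⟨_, _, this.1.trans this.2, key⟩

theorem open_lemma {A : Set (EuclideanSpace ℝ (Fin n))} (hA : RelOpen A)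
    (l : EuclideanSpace ℝ (Fin n) →L[ℝ] ℝ) (hb : BddAbove (l '' A)) (hb' : BddBelow (l '' A)) :
    ∃ (p : ℝ) (g : ℝ → ℤ), ∀ t, (∀ᶠ s in 𝓝[>] t, chi (slice A l s) = g t) ∧
      chi (slice A l t) - g t = if t = p then chi A else 0 := by
  rcases A.eq_empty_or_nonempty with rfl | ⟨x, hx⟩
  · refine ⟨0, 0, fun t => ?_⟩
    have : ∀ s, slice (∅ : Set (EuclideanSpace ℝ (Fin n))) l s = ∅ := by
      intro s; ext; simp [slice]
    simp [this, chi_empty]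
  by_cases hc : ∀ y ∈ A, l y = l x
  · have h1 : slice A l (l x) = A := by
      ext z; exact ⟨fun h => h.1, fun h => ⟨h, hc z h⟩⟩
    have h2 : ∀ t, t ≠ l x → slice A l t = ∅ := by
      intro t ht
      ext z
      simp only [Set.mem_empty_iff_false, iff_false]
      rintro ⟨h, h'⟩
      exact ht (h'.symm.trans (hc z h))
    refine ⟨l x, 0, fun t => ⟨?_, ?_⟩⟩
    · filter_upwards [ev_ne (l x) t] with s hs
      rw [h2 s hs, chi_empty]; rfl
    · by_cases ht : t = l x
      · simp [ht, h1]
      · simp [ht, h2 t ht, chi_empty]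
  · push Not at hc
    obtain ⟨y, hy, hyx⟩ := hc
    obtain ⟨a, b, hab, h⟩ := image_Ioo hA l hb hb' hy hx hyx
    have key : ∀ t, chi (slice A l t) = if a < t ∧ t < b then -chi A else 0 := by
      intro t
      split_ifs with ht
      · obtain ⟨z, hz, rfl⟩ := (h t).2 ht
        obtain ⟨w, hw, hwz⟩ : ∃ w ∈ A, l w ≠ l z := by
          by_contra! h
          exact hyx ((h y hy).trans (h x hx).symm)
        have h1 := slice_dim hA l hz hw hwz
        have h2 : (slice A l (l z)).Nonempty := ⟨z, hz, rfl⟩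
        have h3 : A.Nonempty := ⟨z, hz⟩
        simp only [chi, h2, h3, if_true, h1, pow_succ]
        ring
      · have : ¬ (slice A l t).Nonempty := by
          rintro ⟨z, hz, hz'⟩
          exact ht ((h t).1 ⟨z, hz, hz'⟩)
        simp [chi, this]
    refine ⟨a, fun t => if a ≤ t ∧ t < b then -chi A else 0, fun t => ⟨?_, ?_⟩⟩
    · filter_upwards [ev_Ioo a b t] with s hs
      simp only [key, hs]
    · simp only [key]
      by_cases hta : t = a
      · subst hta
        simp [hab]
      · have : a < t ↔ a ≤ t := ⟨le_of_lt, fun h => lt_of_le_of_ne h (Ne.symm hta)⟩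
        simp [hta, this]

open Classical in
/-- Euler characteristic of a compact convex set. -/
noncomputable def chiK (K : Set (EuclideanSpace ℝ (Fin n))) : ℤ := if K.Nonempty then 1 else 0

theorem compact_lemma {K : Set (EuclideanSpace ℝ (Fin n))} (hK : IsCompact K) (hc : Convex ℝ K)
    (hne : K.Nonempty) (l : EuclideanSpace ℝ (Fin n) →L[ℝ] ℝ) :
    ∃ (p : ℝ) (g : ℝ → ℤ), ∀ t, (∀ᶠ s in 𝓝[>] t, chiK (slice K l s) = g t) ∧
      chiK (slice K l t) - g t = if t = p then chiK K else 0 := by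
  obtain ⟨x, hx, hmin⟩ := hK.exists_isMinOn hne l.continuous.continuousOn
  obtain ⟨y, hy, hmax⟩ := hK.exists_isMaxOn hne l.continuous.continuousOn
  have hxy : l x ≤ l y := hmin hy
  have hord : (l '' K).OrdConnected :=
    (hc.is_linear_image (l : EuclideanSpace ℝ (Fin n) →ₗ[ℝ] ℝ).isLinear).ordConnected
  have key : ∀ t, chiK (slice K l t) = if l x ≤ t ∧ t ≤ l y then 1 else 0 := by
    intro t
    have : (slice K l t).Nonempty ↔ l x ≤ t ∧ t ≤ l y := by
      constructor
      · rintro ⟨z, hz, rfl⟩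
        exact ⟨hmin hz, hmax hz⟩
      · rintro ⟨h1, h2⟩
        obtain ⟨z, hz, hz'⟩ := hord.out ⟨x, hx, rfl⟩ ⟨y, hy, rfl⟩ ⟨h1, h2⟩
        exact ⟨z, hz, hz'⟩
    simp only [chiK, this]
  refine ⟨l y, fun t => if l x ≤ t ∧ t < l y then 1 else 0, fun t => ⟨?_, ?_⟩⟩
  · filter_upwards [ev_Icc (l x) (l y) t] with s hs
    simp only [key, hs]
  · simp only [key]
    by_cases hta : t = l y
    · subst hta
      simp [hxy, chiK, hne]
    · have : t < l y ↔ t ≤ l y := ⟨le_of_lt, fun h => lt_of_le_of_ne h hta⟩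
      simp [hta, this]

theorem sub_of_sum {ι : Type*} {s : Finset ι} {K : Set (EuclideanSpace ℝ (Fin n))}
    {A : ι → Set (EuclideanSpace ℝ (Fin n))}
    (h : ∀ x, ∑ i ∈ s, (A i).indicator (fun _ => (1 : ℤ)) x = K.indicator (fun _ => (1 : ℤ)) x)
    {i : ι} (hi : i ∈ s) : A i ⊆ K := by
  intro x hx
  by_contra hK
  have := h x
  rw [Set.indicator_of_notMem hK, Finset.sum_eq_zero_iff_of_nonneg
    (fun i _ => Set.indicator_nonneg (fun _ _ => zero_le_one) x)] at this
  have h2 := this i hi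
  rw [Set.indicator_of_mem hx] at h2
  exact one_ne_zero h2

theorem pdim_singleton (x : EuclideanSpace ℝ (Fin n)) : pdim {x} = 0 := by
  simp [pdim, direction_affineSpan]

theorem valuation {ι : Type*} (s : Finset ι) (k : ℕ) :
    ∀ (W : Submodule ℝ (EuclideanSpace ℝ (Fin n))), Module.finrank ℝ W ≤ k →
    ∀ (K : Set (EuclideanSpace ℝ (Fin n))) (A : ι → Set (EuclideanSpace ℝ (Fin n))),
    IsCompact K → Convex ℝ K → (∀ i ∈ s, RelOpen (A i)) → (∀ x ∈ K, ∀ y ∈ K, x - y ∈ W) →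
    (∀ x, ∑ i ∈ s, (A i).indicator (fun _ => (1 : ℤ)) x = K.indicator (fun _ => (1 : ℤ)) x) →
    ∑ i ∈ s, chi (A i) = chiK K := by
  classical
  induction k with
  | zero =>
    intro W hW K A hK hKc hA hKW h
    have hW : W = ⊥ := by
      rw [← Submodule.finrank_eq_zero (R := ℝ)]; omega
    rcases K.eq_empty_or_nonempty with rfl | ⟨x, hx⟩
    · simp only [chiK, Set.not_nonempty_empty, if_false]
      refine Finset.sum_eq_zero fun i hi => ?_
      rw [Set.subset_empty_iff.1 (sub_of_sum h hi), chi_empty]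
    · have hKx : ∀ y ∈ K, y = x := by
        intro y hy
        have := hKW y hy x hx
        rw [hW, Submodule.mem_bot, sub_eq_zero] at this
        exact this
      have h1 : chiK K = K.indicator (fun _ => (1 : ℤ)) x := by
        simp [chiK, hx, show K.Nonempty from ⟨x, hx⟩]
      rw [h1, ← h x]
      refine Finset.sum_congr rfl fun i hi => ?_
      have hs := sub_of_sum h hi
      by_cases hxi : x ∈ A i
      · have : A i = {x} := by
          ext z
          exact ⟨fun hz => hKx z (hs hz), fun hz => by rw [Set.mem_singleton_iff.1 hz]; exact hxi⟩
        rw [this]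
        simp [chi, pdim_singleton]
      · have : A i = ∅ := by
          ext z
          simp only [Set.mem_empty_iff_false, iff_false]
          intro hz
          exact hxi (hKx z (hs hz) ▸ hz)
        rw [this]
        simp [chi_empty]
  | succ k ih =>
    intro W hW K A hK hKc hA hKW h
    by_cases hsub : ∀ x ∈ K, ∀ y ∈ K, x = y
    · exact ih ⊥ (by simp) K A hK hKc hA (fun x hx y hy => by simp [hsub x hx y hy]) h
    push Not at hsub
    obtain ⟨x, hx, y, hy, hxy⟩ := hsub
    have hne : K.Nonempty := ⟨x, hx⟩
    set l : EuclideanSpace ℝ (Fin n) →L[ℝ] ℝ := innerSL ℝ (x - y) with hl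
    have hlw : l (x - y) ≠ 0 := by
      have : x - y ≠ 0 := sub_ne_zero.2 hxy
      simp only [hl, innerSL_apply_apply]
      exact inner_self_ne_zero.2 this
    have hW' : Module.finrank ℝ ↥(W ⊓ LinearMap.ker (l : EuclideanSpace ℝ (Fin n) →ₗ[ℝ] ℝ)) ≤ k := by
      have : W ⊓ LinearMap.ker (l : EuclideanSpace ℝ (Fin n) →ₗ[ℝ] ℝ) < W := by
        refine lt_of_le_of_ne inf_le_left fun he => ?_
        have h1 := hKW x hx y hy
        rw [← he] at h1
        exact hlw h1.2
      have := Submodule.finrank_lt_finrank_of_lt this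
      omega
    have hslice : ∀ t, ∑ i ∈ s, chi (slice (A i) l t) = chiK (slice K l t) := by
      intro t
      refine ih _ hW' (slice K l t) (fun i => slice (A i) l t) ?_ ?_ ?_ ?_ ?_
      · exact hK.inter_right (isClosed_eq l.continuous continuous_const)
      · intro u hu v hv a b ha hb hab
        refine ⟨hKc hu.1 hv.1 ha hb hab, ?_⟩
        simp [hu.2, hv.2, ← add_mul, hab]
      · exact fun i hi => slice_relOpen (hA i hi) l t
      · intro u hu v hv
        refine ⟨hKW u hu.1 v hv.1, ?_⟩
        show l (u - v) = 0
        simp [hu.2, hv.2]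
      · intro u
        by_cases hu : l u = t
        · have := h u
          simpa only [Set.indicator, slice, Set.mem_ofPred_eq, hu, and_true] using this
        · simp [Set.indicator, slice, hu]
    have hbd : ∀ i ∈ s, BddAbove (l '' A i) ∧ BddBelow (l '' A i) := fun i hi =>
      ⟨(hK.bddAbove_image l.continuous.continuousOn).mono (Set.image_mono (sub_of_sum h hi)),
        (hK.bddBelow_image l.continuous.continuousOn).mono (Set.image_mono (sub_of_sum h hi))⟩
    have hop : ∀ i, ∃ (p : ℝ) (g : ℝ → ℤ), i ∈ s → ∀ t,
      (∀ᶠ u in 𝓝[>] t, chi (slice (A i) l u) = g t) ∧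
      chi (slice (A i) l t) - g t = if t = p then chi (A i) else 0 := by
      intro i
      by_cases hi : i ∈ s
      · obtain ⟨p, g, hh⟩ := open_lemma (hA i hi) l (hbd i hi).1 (hbd i hi).2
        exact ⟨p, g, fun _ => hh⟩
      · exact ⟨0, 0, fun h => absurd h hi⟩
    choose p g hpg using hop
    obtain ⟨q, f, hqf⟩ := compact_lemma hK hKc hne l
    have hlim : ∀ t, ∑ i ∈ s, g i t = f t := by
      intro t
      have h1 : ∀ᶠ u in 𝓝[>] t, ∀ i ∈ s, chi (slice (A i) l u) = g i t :=
        (Filter.eventually_all_finset s).2 fun i hi => (hpg i hi t).1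
      obtain ⟨u, hu1, hu2⟩ := (h1.and (hqf t).1).exists
      rw [← hu2, ← hslice u]
      exact Finset.sum_congr rfl fun i hi => (hu1 i hi).symm
    have hpt : ∀ t, ∑ i ∈ s, (if t = p i then chi (A i) else 0) = if t = q then chiK K else 0 := by
      intro t
      rw [← (hqf t).2, ← hslice t, ← hlim t, ← Finset.sum_sub_distrib]
      exact Finset.sum_congr rfl fun i hi => ((hpg i hi t).2).symm
    have hT := Finset.sum_congr (rfl : insert q (s.image p) = _) (fun t _ => hpt t)
    rw [Finset.sum_comm] at hT
    rw [Finset.sum_ite_eq' _ q, if_pos (Finset.mem_insert_self _ _)] at hT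
    rw [← hT]
    refine Finset.sum_congr rfl fun i hi => ?_
    rw [Finset.sum_ite_eq' _ (p i), if_pos]
    exact Finset.mem_insert_of_mem (Finset.mem_image_of_mem p hi)

/-- Strictly positive convex combinations of all points of `T`. -/
def openHull (T : Finset (EuclideanSpace ℝ (Fin n))) : Set (EuclideanSpace ℝ (Fin n)) :=
  {x | ∃ w : EuclideanSpace ℝ (Fin n) → ℝ, (∀ t ∈ T, 0 < w t) ∧ ∑ t ∈ T, w t = 1 ∧
    ∑ t ∈ T, w t • t = x}

theorem openHull_subset (T : Finset (EuclideanSpace ℝ (Fin n))) :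
    openHull T ⊆ convexHull ℝ (T : Set (EuclideanSpace ℝ (Fin n))) := by
  rintro x ⟨w, h0, h1, h2⟩
  rw [Finset.mem_convexHull']
  exact ⟨w, fun t ht => (h0 t ht).le, h1, h2⟩

theorem openHull_relOpen (T : Finset (EuclideanSpace ℝ (Fin n))) : RelOpen (openHull T) := by
  refine ⟨?_, ?_⟩
  · rw [convex_iff_forall_pos]
    rintro x ⟨w, hw0, hw1, rfl⟩ y ⟨v, hv0, hv1, rfl⟩ a b ha hb hab
    refine ⟨fun t => a * w t + b * v t, ?_, ?_, ?_⟩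
    · intro t ht
      have := hw0 t ht
      have := hv0 t ht
      positivity
    · rw [Finset.sum_add_distrib, ← Finset.mul_sum, ← Finset.mul_sum, hw1, hv1]; linarith
    · simp only [add_smul, mul_smul, Finset.sum_add_distrib, Finset.smul_sum]
  · rintro x ⟨w, hw0, hw1, rfl⟩ y ⟨v, hv0, hv1, rfl⟩
    have h1 : ∀ᶠ ε in 𝓝[>] (0 : ℝ), ∀ t ∈ T, 0 < w t + ε * (w t - v t) := by
      refine (Filter.eventually_all_finset T).2 fun t ht => ?_
      have hc : Continuous fun ε : ℝ => w t + ε * (w t - v t) := by fun_prop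
      have : ∀ᶠ ε in 𝓝 (0 : ℝ), 0 < w t + ε * (w t - v t) :=
        hc.continuousAt.eventually (lt_mem_nhds (by simpa using hw0 t ht))
      exact this.filter_mono nhdsWithin_le_nhds
    have h0 : ∀ᶠ ε in 𝓝[>] (0 : ℝ), 0 < ε := self_mem_nhdsWithin
    obtain ⟨ε, hε, h⟩ := (h0.and h1).exists
    refine ⟨ε, hε, fun t => w t + ε * (w t - v t), h, ?_, ?_⟩
    · rw [Finset.sum_add_distrib, ← Finset.mul_sum, Finset.sum_sub_distrib, hw1, hv1]; simp
    · simp only [add_smul, mul_smul, sub_smul, Finset.sum_add_distrib, Finset.smul_sum, smul_sub,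
        Finset.sum_sub_distrib]

theorem openHull_nonempty {T : Finset (EuclideanSpace ℝ (Fin n))} (hT : T.Nonempty) :
    (openHull T).Nonempty := by
  have : (0 : ℝ) < T.card := by exact_mod_cast hT.card_pos
  refine ⟨_, fun _ => (T.card : ℝ)⁻¹, fun t _ => by positivity, ?_, rfl⟩
  simp [this.ne']

theorem openHull_pdim {T : Finset (EuclideanSpace ℝ (Fin n))} (hT : T.Nonempty) :
    pdim (openHull T) = pdim (convexHull ℝ (T : Set (EuclideanSpace ℝ (Fin n)))) := by
  classical
  have : affineSpan ℝ (openHull T) =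
      affineSpan ℝ (convexHull ℝ (T : Set (EuclideanSpace ℝ (Fin n)))) := by
    apply le_antisymm
    · exact affineSpan_mono ℝ (openHull_subset T)
    · rw [affineSpan_convexHull, affineSpan_le]
      intro t ht
      replace ht : t ∈ T := ht
      obtain ⟨x, hx⟩ := openHull_nonempty hT
      have hy : (1 / 2 : ℝ) • x + (1 / 2 : ℝ) • t ∈ openHull T := by
        obtain ⟨w, hw0, hw1, rfl⟩ := hx
        refine ⟨fun s => (1 / 2) * w s + (1 / 2) * (if s = t then 1 else 0), ?_, ?_, ?_⟩
        · intro s hs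
          have := hw0 s hs
          positivity
        · rw [Finset.sum_add_distrib, ← Finset.mul_sum, ← Finset.mul_sum, hw1,
            Finset.sum_ite_eq' T t, if_pos ht]
          norm_num
        · simp only [add_smul, mul_smul, Finset.sum_add_distrib, Finset.smul_sum, ite_smul,
            one_smul, zero_smul, smul_ite, smul_zero]
          rw [Finset.sum_ite_eq' T t, if_pos ht]
      have h := AffineMap.lineMap_mem (2 : ℝ) (subset_affineSpan ℝ _ hx) (subset_affineSpan ℝ _ hy)
      have e : AffineMap.lineMap x ((1 / 2 : ℝ) • x + (1 / 2 : ℝ) • t) (2 : ℝ) = t := by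
        rw [AffineMap.lineMap_apply]
        simp only [vsub_eq_sub, vadd_eq_add]
        module
      rwa [e] at h
  unfold pdim
  rw [this]

/-- Vertex subsets cut out by a supporting hyperplane. -/
def IsF (S T : Finset (EuclideanSpace ℝ (Fin n))) : Prop :=
  T.Nonempty ∧ ∃ (l : EuclideanSpace ℝ (Fin n) →L[ℝ] ℝ) (M : ℝ), (∀ s ∈ S, l s ≤ M) ∧
    ∀ s, s ∈ T ↔ s ∈ S ∧ l s = M

theorem le_on_hull {S : Finset (EuclideanSpace ℝ (Fin n))}
    {l : EuclideanSpace ℝ (Fin n) →L[ℝ] ℝ} {M : ℝ} (h : ∀ s ∈ S, l s ≤ M)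
    {x : EuclideanSpace ℝ (Fin n)} (hx : x ∈ convexHull ℝ (S : Set (EuclideanSpace ℝ (Fin n)))) :
    l x ≤ M := by
  rw [Finset.mem_convexHull'] at hx
  obtain ⟨w, h0, h1, rfl⟩ := hx
  rw [map_sum]
  calc ∑ s ∈ S, l (w s • s) ≤ ∑ s ∈ S, w s * M := Finset.sum_le_sum fun s hs => by
        simpa using mul_le_mul_of_nonneg_left (h s hs) (h0 s hs)
    _ = M := by rw [← Finset.sum_mul, h1, one_mul]

theorem eq_of_max {S : Finset (EuclideanSpace ℝ (Fin n))}
    {l : EuclideanSpace ℝ (Fin n) →L[ℝ] ℝ} {M : ℝ} (h : ∀ s ∈ S, l s ≤ M)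
    {w : EuclideanSpace ℝ (Fin n) → ℝ} (h0 : ∀ s ∈ S, 0 ≤ w s) (h1 : ∑ s ∈ S, w s = 1)
    (hx : l (∑ s ∈ S, w s • s) = M) : ∀ s ∈ S, w s ≠ 0 → l s = M := by
  have e : ∑ s ∈ S, w s * (M - l s) = 0 := by
    simp only [mul_sub, Finset.sum_sub_distrib, ← Finset.sum_mul, h1, one_mul]
    rw [map_sum] at hx
    simp only [map_smul, smul_eq_mul] at hx
    linarith
  rw [Finset.sum_eq_zero_iff_of_nonneg
    (fun s hs => mul_nonneg (h0 s hs) (by linarith [h s hs]))] at e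
  intro s hs hws
  rcases mul_eq_zero.1 (e s hs) with h | h
  · exact absurd h hws
  · linarith

theorem eq_on_hull {T : Finset (EuclideanSpace ℝ (Fin n))}
    {l : EuclideanSpace ℝ (Fin n) →L[ℝ] ℝ} {M : ℝ} (h : ∀ s ∈ T, l s = M)
    {x : EuclideanSpace ℝ (Fin n)} (hx : x ∈ convexHull ℝ (T : Set (EuclideanSpace ℝ (Fin n)))) :
    l x = M := by
  apply le_antisymm (le_on_hull (fun s hs => (h s hs).le) hx)
  have := le_on_hull (l := -l) (M := -M) (fun s hs => by simp [h s hs]) hx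
  simpa using this

theorem hull_face {S T : Finset (EuclideanSpace ℝ (Fin n))}
    {l : EuclideanSpace ℝ (Fin n) →L[ℝ] ℝ} {M : ℝ} (h : ∀ s ∈ S, l s ≤ M)
    (hT : ∀ s, s ∈ T ↔ s ∈ S ∧ l s = M) (x : EuclideanSpace ℝ (Fin n)) :
    x ∈ convexHull ℝ (T : Set (EuclideanSpace ℝ (Fin n))) ↔
      x ∈ convexHull ℝ (S : Set (EuclideanSpace ℝ (Fin n))) ∧ l x = M := by
  have hTS : T ⊆ S := fun s hs => ((hT s).1 hs).1
  constructor
  · intro hx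
    exact ⟨convexHull_mono (by exact_mod_cast hTS) hx,
      eq_on_hull (fun s hs => ((hT s).1 hs).2) hx⟩
  · rintro ⟨hx, hM⟩
    rw [Finset.mem_convexHull'] at hx ⊢
    obtain ⟨w, h0, h1, rfl⟩ := hx
    have key := eq_of_max h h0 h1 hM
    have hz : ∀ s ∈ S, s ∉ T → w s = 0 := by
      intro s hs hsT
      by_contra hne
      exact hsT ((hT s).2 ⟨hs, key s hs hne⟩)
    refine ⟨w, fun s hs => h0 s (hTS hs), ?_, ?_⟩
    · rw [← h1]; exact Finset.sum_subset hTS hz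
    · exact Finset.sum_subset hTS fun s hs hsT => by rw [hz s hs hsT, zero_smul]

theorem face_sub {S T U : Finset (EuclideanSpace ℝ (Fin n))} (hT : IsF S T) (hU : IsF S U)
    {x : EuclideanSpace ℝ (Fin n)} (hx : x ∈ openHull T) (hx' : x ∈ openHull U) : T ⊆ U := by
  obtain ⟨-, l', M', -, hT'⟩ := hT
  obtain ⟨-, l, M, hM, hU'⟩ := hU
  have h1 : l x = M := eq_on_hull (fun s hs => ((hU' s).1 hs).2) (openHull_subset U hx')
  obtain ⟨w, h0, hw, rfl⟩ := hx
  have hTS : T ⊆ S := fun s hs => ((hT' s).1 hs).1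
  intro t ht
  exact (hU' t).2 ⟨hTS ht, eq_of_max (fun s hs => hM s (hTS hs)) (fun s hs => (h0 s hs).le) hw h1
    t ht (h0 t ht).ne'⟩

theorem exists_face {S : Finset (EuclideanSpace ℝ (Fin n))} {x : EuclideanSpace ℝ (Fin n)}
    (hx : x ∈ convexHull ℝ (S : Set (EuclideanSpace ℝ (Fin n)))) :
    ∃ T, IsF S T ∧ x ∈ openHull T := by
  classical
  rw [Finset.mem_convexHull'] at hx
  let R : (EuclideanSpace ℝ (Fin n) → ℝ) → Prop := fun w =>
    (∀ s ∈ S, 0 ≤ w s) ∧ ∑ s ∈ S, w s = 1 ∧ ∑ s ∈ S, w s • s = x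
  obtain ⟨w0, hw0⟩ : ∃ w, R w := hx
  let T := S.filter fun t => ∃ w, R w ∧ 0 < w t
  have hTS : T ⊆ S := Finset.filter_subset _ _
  have hoff : ∀ w, R w → ∀ s ∈ S, s ∉ T → w s = 0 := by
    intro w hw s hs hsT
    by_contra hne
    exact hsT (Finset.mem_filter.2 ⟨hs, w, hw, lt_of_le_of_ne (hw.1 s hs) (Ne.symm hne)⟩)
  have hTne : T.Nonempty := by
    by_contra hT
    rw [Finset.not_nonempty_iff_eq_empty] at hT
    have := hw0.2.1
    rw [Finset.sum_eq_zero fun s hs => hoff w0 hw0 s hs (by simp [hT])] at this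
    exact zero_ne_one this
  have hcard : (0 : ℝ) < T.card := by exact_mod_cast hTne.card_pos
  have hch : ∀ t, ∃ w, R w ∧ (t ∈ T → 0 < w t) := by
    intro t
    by_cases ht : t ∈ T
    · obtain ⟨-, w, hw, hp⟩ := Finset.mem_filter.1 ht
      exact ⟨w, hw, fun _ => hp⟩
    · exact ⟨w0, hw0, fun h => absurd h ht⟩
  choose W hW hWp using hch
  have hmem : x ∈ openHull T := by
    refine ⟨fun s => (T.card : ℝ)⁻¹ * ∑ t ∈ T, W t s, ?_, ?_, ?_⟩
    · intro s hs
      refine mul_pos (by positivity) (Finset.sum_pos' (fun t _ => (hW t).1 s (hTS hs)) ⟨s, hs, hWp s hs⟩)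
    · rw [← Finset.mul_sum, Finset.sum_comm]
      have : ∀ t ∈ T, ∑ s ∈ T, W t s = 1 := fun t _ => by
        rw [← (hW t).2.1]; exact Finset.sum_subset hTS (hoff _ (hW t))
      rw [Finset.sum_congr rfl this]
      simp [hcard.ne']
    · simp only [mul_smul, Finset.sum_smul]
      rw [← Finset.smul_sum, Finset.sum_comm]
      have : ∀ t ∈ T, ∑ s ∈ T, W t s • s = x := fun t _ => by
        rw [← (hW t).2.2]
        exact Finset.sum_subset hTS fun s hs hsT => by rw [hoff _ (hW t) s hs hsT, zero_smul]
      rw [Finset.sum_congr rfl this, Finset.sum_const, ← Nat.cast_smul_eq_nsmul ℝ, smul_smul,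
        inv_mul_cancel₀ hcard.ne', one_smul]
  have hsep : ∀ t, ∃ l : EuclideanSpace ℝ (Fin n) →L[ℝ] ℝ, t ∈ S \ T →
      (∀ s ∈ S, l s ≤ l x) ∧ l t < l x := by
    intro t
    by_cases ht : t ∈ S \ T
    swap
    · exact ⟨0, fun h => absurd h ht⟩
    obtain ⟨htS, htT⟩ := Finset.mem_sdiff.1 ht
    rcases farkas S (fun s => x - s) (t - x) with ⟨c, hc, he⟩ | ⟨l, hl, hlt⟩
    · exfalso
      apply htT
      have hC : 0 ≤ ∑ s ∈ S, c s := Finset.sum_nonneg hc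
      have hC1 : 0 < 1 + ∑ s ∈ S, c s := by linarith
      refine Finset.mem_filter.2 ⟨htS, fun s => (1 + ∑ s ∈ S, c s)⁻¹ * (c s + if s = t then 1 else 0),
        ⟨?_, ?_, ?_⟩, ?_⟩
      · intro s hs
        have := hc s hs
        positivity
      · rw [← Finset.mul_sum, Finset.sum_add_distrib, Finset.sum_ite_eq' S t, if_pos htS,
          add_comm (∑ s ∈ S, c s), inv_mul_cancel₀ hC1.ne']
      · simp only [mul_smul]
        rw [← Finset.smul_sum, inv_smul_eq_iff₀ hC1.ne']
        simp only [add_smul, Finset.sum_add_distrib, ite_smul, one_smul, zero_smul]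
        rw [Finset.sum_ite_eq' S t, if_pos htS]
        simp only [smul_sub, Finset.sum_sub_distrib, ← Finset.sum_smul] at he
        rw [sub_eq_iff_eq_add] at he
        rw [he]
        abel
      · have := hc t htS
        simp only [if_true]
        positivity
    · refine ⟨l, fun _ => ⟨fun s hs => ?_, ?_⟩⟩
      · have := hl s hs
        rw [map_sub] at this
        linarith
      · rw [map_sub] at hlt
        linarith
  choose L hL using hsep
  refine ⟨T, ⟨hTne, ∑ t ∈ S \ T, L t, (∑ t ∈ S \ T, L t) x, ?_, ?_⟩, hmem⟩
  · intro s hs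
    simp only [_root_.sum_apply]
    exact Finset.sum_le_sum fun t ht => (hL t ht).1 s hs
  · have hle : ∀ s ∈ S, (∑ t ∈ S \ T, L t) s ≤ (∑ t ∈ S \ T, L t) x := by
      intro s hs
      simp only [_root_.sum_apply]
      exact Finset.sum_le_sum fun t ht => (hL t ht).1 s hs
    intro s
    constructor
    · intro hs
      refine ⟨hTS hs, ?_⟩
      obtain ⟨w, h0, h1, h2⟩ := hmem
      exact eq_of_max (fun s hs => hle s (hTS hs)) (fun s hs => (h0 s hs).le) h1 (by rw [h2]) s hs
        (h0 s hs).ne'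
    · rintro ⟨hs, he⟩
      by_contra hsT
      have hs' : s ∈ S \ T := Finset.mem_sdiff.2 ⟨hs, hsT⟩
      have : (∑ t ∈ S \ T, L t) s < (∑ t ∈ S \ T, L t) x := by
        simp only [_root_.sum_apply]
        exact Finset.sum_lt_sum (fun t ht => (hL t ht).1 s hs) ⟨s, hs', (hL s hs').2⟩
      exact this.ne he

theorem exposed_iff {S : Finset (EuclideanSpace ℝ (Fin n))} (F : Set (EuclideanSpace ℝ (Fin n))) :
    (IsExposed ℝ (convexHull ℝ (S : Set (EuclideanSpace ℝ (Fin n)))) F ∧ F.Nonempty) ↔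
      ∃ T, IsF S T ∧ convexHull ℝ (T : Set (EuclideanSpace ℝ (Fin n))) = F := by
  classical
  constructor
  · rintro ⟨hF, x, hx⟩
    obtain ⟨l, rfl⟩ := hF ⟨x, hx⟩
    have hM : ∀ s ∈ S, l s ≤ l x := fun s hs => hx.2 s (subset_convexHull ℝ _ hs)
    have hT : ∀ s, s ∈ S.filter (fun s => l s = l x) ↔ s ∈ S ∧ l s = l x := fun s => by simp
    have e := hull_face hM hT
    refine ⟨S.filter (fun s => l s = l x), ⟨?_, l, l x, hM, hT⟩, ?_⟩
    · have : (convexHull ℝ ((S.filter (fun s => l s = l x) : Finset _) :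
          Set (EuclideanSpace ℝ (Fin n)))).Nonempty := ⟨x, (e x).2 ⟨hx.1, rfl⟩⟩
      exact_mod_cast convexHull_nonempty_iff.1 this
    · ext z
      rw [e z]
      constructor
      · rintro ⟨hz, hzx⟩
        exact ⟨hz, fun y hy => hzx ▸ hx.2 y hy⟩
      · rintro ⟨hz, hzx⟩
        exact ⟨hz, le_antisymm (hx.2 z hz) (hzx x hx.1)⟩
  · rintro ⟨T, ⟨hne, l, M, hM, hT⟩, rfl⟩
    have e := hull_face hM hT
    have hne' : (convexHull ℝ (T : Set (EuclideanSpace ℝ (Fin n)))).Nonempty := by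
      rw [convexHull_nonempty_iff]; exact_mod_cast hne
    refine ⟨fun _ => ⟨l, ?_⟩, hne'⟩
    ext z
    rw [e z]
    constructor
    · rintro ⟨hz, hzx⟩
      exact ⟨hz, fun y hy => hzx ▸ le_on_hull hM hy⟩
    · rintro ⟨hz, hzx⟩
      obtain ⟨x, hx⟩ := hne'
      have := (e x).1 hx
      exact ⟨hz, le_antisymm (le_on_hull hM hz) (this.2 ▸ hzx x this.1)⟩

theorem face_inj {S T U : Finset (EuclideanSpace ℝ (Fin n))} (hT : IsF S T) (hU : IsF S U)
    (h : convexHull ℝ (T : Set (EuclideanSpace ℝ (Fin n))) =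
      convexHull ℝ (U : Set (EuclideanSpace ℝ (Fin n)))) : T = U := by
  have key : ∀ T U, IsF S T → IsF S U → convexHull ℝ (T : Set (EuclideanSpace ℝ (Fin n))) =
      convexHull ℝ (U : Set (EuclideanSpace ℝ (Fin n))) → T ⊆ U := by
    rintro T U ⟨-, l', M', -, hT⟩ ⟨-, l, M, hM, hU⟩ h t ht
    have : t ∈ convexHull ℝ (T : Set (EuclideanSpace ℝ (Fin n))) := subset_convexHull ℝ _ ht
    rw [h, hull_face hM hU] at this
    exact (hU t).2 ⟨((hT t).1 ht).1, this.2⟩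
  exact (key T U hT hU h).antisymm (key U T hU hT h.symm)

theorem main {P : Set (EuclideanSpace ℝ (Fin n))} (hP : IsPolytope P) :
    ∑ c ∈ Finset.range (pdim P + 1), (-1 : ℤ) ^ c * (fc P c : ℤ) = 1 := by
  classical
  obtain ⟨S, hS, rfl⟩ := hP
  set P := convexHull ℝ (S : Set (EuclideanSpace ℝ (Fin n))) with hPdef
  let 𝓕 : Finset (Finset (EuclideanSpace ℝ (Fin n))) := S.powerset.filter (IsF S)
  have h𝓕 : ∀ T, T ∈ 𝓕 ↔ IsF S T := by
    intro T
    simp only [𝓕, Finset.mem_filter, Finset.mem_powerset, and_iff_right_iff_imp]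
    rintro ⟨-, l, M, -, hT⟩ t ht
    exact ((hT t).1 ht).1
  let D : Finset (EuclideanSpace ℝ (Fin n)) → ℕ := fun T =>
    pdim (convexHull ℝ (T : Set (EuclideanSpace ℝ (Fin n))))
  have hval : ∑ T ∈ 𝓕, chi (openHull T) = chiK P := by
    refine valuation 𝓕 _ ⊤ le_rfl P openHull (S.finite_toSet.isCompact_convexHull ℝ)
      (convex_convexHull ℝ _) (fun T _ => openHull_relOpen T) (by simp) ?_
    intro x
    by_cases hx : x ∈ P
    · obtain ⟨T, hT, hxT⟩ := exists_face hx
      rw [Finset.sum_eq_single_of_mem T ((h𝓕 T).2 hT), Set.indicator_of_mem hxT,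
        Set.indicator_of_mem hx]
      intro U hU hne
      rw [Set.indicator_of_notMem]
      intro hxU
      have hU' := (h𝓕 U).1 hU
      exact hne ((face_sub hU' hT hxU hxT).antisymm (face_sub hT hU' hxT hxU))
    · rw [Set.indicator_of_notMem hx]
      refine Finset.sum_eq_zero fun T hT => Set.indicator_of_notMem (fun hxT => hx ?_) _
      obtain ⟨-, l, M, hM, hT'⟩ := (h𝓕 T).1 hT
      exact ((hull_face hM hT' x).1 (openHull_subset T hxT)).1
  have hPne : P.Nonempty := by
    rw [hPdef, convexHull_nonempty_iff]; exact_mod_cast hS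
  have hval2 : ∑ T ∈ 𝓕, (-1 : ℤ) ^ D T = 1 := by
    refine Eq.trans ?_ (hval.trans (show chiK P = (1 : ℤ) by simp [chiK, hPne]))
    refine Finset.sum_congr rfl fun T hT => ?_
    have hne := ((h𝓕 T).1 hT).1
    simp only [chi, openHull_nonempty hne, if_true, openHull_pdim hne, D]
  have hfc : ∀ c, fc P c = (𝓕.filter fun T => D T = c).card := by
    intro c
    have : {F | IsFaceDim P F c} = (fun T : Finset (EuclideanSpace ℝ (Fin n)) =>
        convexHull ℝ (T : Set (EuclideanSpace ℝ (Fin n)))) '' (𝓕.filter fun T => D T = c :) := by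
      ext F
      simp only [Set.mem_image, Finset.mem_coe, Finset.mem_filter, h𝓕]
      constructor
      · rintro ⟨h1, h2, h3⟩
        obtain ⟨T, hT, rfl⟩ := (exposed_iff F).1 ⟨h1, h2⟩
        exact ⟨T, ⟨hT, h3⟩, rfl⟩
      · rintro ⟨T, ⟨hT, hc⟩, rfl⟩
        have := (exposed_iff _).2 ⟨T, hT, rfl⟩
        exact ⟨this.1, this.2, hc⟩
    unfold fc
    rw [this, Set.InjOn.ncard_image, Set.ncard_coe_finset]
    intro T hT U hU h
    have hT' := (h𝓕 T).1 (Finset.mem_filter.1 hT).1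
    have hU' := (h𝓕 U).1 (Finset.mem_filter.1 hU).1
    exact face_inj hT' hU' h
  have hmaps : ∀ T ∈ 𝓕, D T ∈ Finset.range (pdim P + 1) := by
    intro T hT
    obtain ⟨-, l, M, hM, hT'⟩ := (h𝓕 T).1 hT
    rw [Finset.mem_range, Nat.lt_succ_iff]
    refine Submodule.finrank_mono (AffineSubspace.direction_le (affineSpan_mono ℝ ?_))
    intro z hz
    exact ((hull_face hM hT' z).1 hz).1
  refine Eq.trans ?_ hval2
  rw [← Finset.sum_fiberwise_of_maps_to hmaps]
  refine Finset.sum_congr rfl fun c _ => ?_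
  have e : ∀ T ∈ 𝓕.filter (fun T => D T = c), (-1 : ℤ) ^ D T = (-1) ^ c := by
    intro T hT
    rw [(Finset.mem_filter.1 hT).2]
  rw [hfc c, Finset.sum_congr rfl e]
  simp [mul_comm]

end EulerAux

/-- Generalized Euler–Poincaré formula (Schläfli 1852): for every convex polytope
of dimension d ≥ 1, the alternating sum of its face numbers equals 1. -/
theorem euler_poincare_formula {n : ℕ} (P : Set (EuclideanSpace ℝ (Fin n)))
    (hP : IsPolytope P) (hd : 1 ≤ pdim P) :
    ∑ c ∈ Finset.range (pdim P + 1), (-1 : ℤ) ^ c * (fc P c : ℤ) = 1 := by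
  exact EulerAux.main hP
end

section
/- Equivalently to the Euler–Poincaré formula: for a convex polytope P of dimension d, counting also the empty face as a face of dimension -1, the alternating sum ∑_{c=-1}^{d} (-1)^c f^c(P) = 0, i.e., the reduced Euler characteristic of the face lattice of P is 0. -/
open Set

section EulerAux

variable {n : ℕ}

/-- Combinatorial Euler characteristic of `A` with respect to the arrangement `hs`. -/
noncomputable def chiAux {n : ℕ} : List (EuclideanSpace ℝ (Fin n)) → Set (EuclideanSpace ℝ (Fin n)) → ℤ
  | [], A => open Classical in
      if A.Nonempty then (-1) ^ (Module.finrank ℝ (Submodule.span ℝ A)) else 0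
  | h :: hs, A => chiAux hs (A ∩ {x | inner ℝ x h = 0}) + chiAux hs (A ∩ {x | 0 < inner ℝ x h})
      + chiAux hs (A ∩ {x | inner ℝ x h < 0})

lemma chiAux_empty (hs : List (EuclideanSpace ℝ (Fin n))) : chiAux hs ∅ = 0 := by
  induction hs with
  | nil => simp [chiAux]
  | cons h hs ih => simp [chiAux, ih]

/-- additivity -/
lemma chiAux_sum {ι : Type*} (I : Finset ι) (j : EuclideanSpace ℝ (Fin n) → ι)
    (hs : List (EuclideanSpace ℝ (Fin n))) (A : Set (EuclideanSpace ℝ (Fin n)))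
    (hI : ∀ x ∈ A, j x ∈ I)
    (hj : ∀ x ∈ A, ∀ y ∈ A, (∀ h ∈ hs, SignType.sign (inner ℝ x h : ℝ) = SignType.sign (inner ℝ y h : ℝ)) → j x = j y) :
    chiAux hs A = ∑ i ∈ I, chiAux hs (A ∩ {x | j x = i}) := by
  classical
  induction hs generalizing A with
  | nil =>
    rcases A.eq_empty_or_nonempty with rfl | ⟨x, hx⟩
    · simp [chiAux]
    · rw [Finset.sum_eq_single (j x)]
      · congr 1
        ext y
        constructor
        · intro hy
          exact ⟨hy, hj y hy x hx (by simp)⟩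
        · exact fun hy => hy.1
      · intro i _ hi
        have : A ∩ {x | j x = i} = ∅ := by
          ext y
          simp only [mem_inter_iff, mem_ofPred_eq, mem_empty_iff_false, iff_false, not_and]
          intro hy h
          exact hi (h ▸ hj y hy x hx (by simp))
        rw [this, chiAux_empty]
      · intro h
        exact absurd (hI x hx) h
  | cons h hs ih =>
    simp only [chiAux]
    rw [Finset.sum_add_distrib, Finset.sum_add_distrib]
    rw [ih (A ∩ {x | inner ℝ x h = 0}) (fun x hx => hI x hx.1), ih (A ∩ {x | 0 < inner ℝ x h}) (fun x hx => hI x hx.1),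
      ih (A ∩ {x | inner ℝ x h < 0}) (fun x hx => hI x hx.1)]
    · simp only [inter_right_comm A]
    · intro x hx y hy hxy
      refine hj x hx.1 y hy.1 ?_
      intro g hg
      rcases List.mem_cons.1 hg with rfl | hg
      · rw [sign_neg hx.2, sign_neg hy.2]
      · exact hxy g hg
    · intro x hx y hy hxy
      refine hj x hx.1 y hy.1 ?_
      intro g hg
      rcases List.mem_cons.1 hg with rfl | hg
      · rw [sign_pos hx.2, sign_pos hy.2]
      · exact hxy g hg
    · intro x hx y hy hxy
      refine hj x hx.1 y hy.1 ?_
      intro g hg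
      rcases List.mem_cons.1 hg with rfl | hg
      · have h1 := hx.2
        have h2 := hy.2
        simp only [mem_ofPred_eq] at h1 h2
        rw [h1, h2]
      · exact hxy g hg

/-- small perturbation inside an open set -/
lemma exists_perturb {O : Set (EuclideanSpace ℝ (Fin n))} (hO : IsOpen O)
    {x : EuclideanSpace ℝ (Fin n)} (hx : x ∈ O) (m : EuclideanSpace ℝ (Fin n)) :
    ∃ ε : ℝ, 0 < ε ∧ x + ε • m ∈ O ∧ x - ε • m ∈ O := by
  have h1 : ∀ᶠ ε : ℝ in nhds 0, x + ε • m ∈ O := by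
    have : Continuous fun ε : ℝ => x + ε • m := by fun_prop
    exact this.continuousAt.eventually (by simpa using hO.mem_nhds hx)
  have h2 : ∀ᶠ ε : ℝ in nhds 0, x - ε • m ∈ O := by
    have : Continuous fun ε : ℝ => x - ε • m := by fun_prop
    exact this.continuousAt.eventually (by simpa using hO.mem_nhds hx)
  have h3 : ∀ᶠ ε : ℝ in nhdsWithin 0 (Ioi 0), 0 < ε := eventually_mem_nhdsWithin
  obtain ⟨ε, h⟩ := (h3.and ((h1.and h2).filter_mono nhdsWithin_le_nhds)).exists
  exact ⟨ε, h.1, h.2.1, h.2.2⟩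

lemma span_open_inter {O : Set (EuclideanSpace ℝ (Fin n))} (hO : IsOpen O)
    (M : Submodule ℝ (EuclideanSpace ℝ (Fin n))) (hne : (O ∩ (M : Set _)).Nonempty) :
    Submodule.span ℝ (O ∩ (M : Set (EuclideanSpace ℝ (Fin n)))) = M := by
  apply le_antisymm
  · rw [Submodule.span_le]
    exact inter_subset_right
  · intro m hm
    obtain ⟨x, hxO, hxM⟩ := hne
    obtain ⟨ε, hε, h1, -⟩ := exists_perturb hO hxO m
    have a1 : x ∈ Submodule.span ℝ (O ∩ (M : Set (EuclideanSpace ℝ (Fin n)))) :=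
      Submodule.subset_span ⟨hxO, hxM⟩
    have a2 : x + ε • m ∈ Submodule.span ℝ (O ∩ (M : Set (EuclideanSpace ℝ (Fin n)))) :=
      Submodule.subset_span ⟨h1, M.add_mem hxM (M.smul_mem _ hm)⟩
    have a3 := Submodule.smul_mem _ ε⁻¹ (Submodule.sub_mem _ a2 a1)
    simpa [smul_smul, inv_mul_cancel₀ hε.ne'] using a3

/-- the form -/
noncomputable def formAux (h : EuclideanSpace ℝ (Fin n)) : EuclideanSpace ℝ (Fin n) →ₗ[ℝ] ℝ :=
  (innerₛₗ ℝ h)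

lemma formAux_apply (h x : EuclideanSpace ℝ (Fin n)) : formAux h x = inner ℝ x h := by
  simp [formAux, real_inner_comm]

lemma finrank_inf_ker (M : Submodule ℝ (EuclideanSpace ℝ (Fin n))) (f : EuclideanSpace ℝ (Fin n) →ₗ[ℝ] ℝ)
    {m : EuclideanSpace ℝ (Fin n)} (hm : m ∈ M) (hfm : f m ≠ 0) :
    Module.finrank ℝ (M ⊓ LinearMap.ker f : Submodule ℝ _) + 1 = Module.finrank ℝ M := by
  have h1 := LinearMap.finrank_range_add_finrank_ker (f.domRestrict M)
  have h2 : LinearMap.range (f.domRestrict M) = ⊤ := by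
    apply LinearMap.range_eq_top.2
    apply LinearMap.surjective
    intro h0
    apply hfm
    have := LinearMap.congr_fun h0 ⟨m, hm⟩
    simpa using this
  rw [h2, finrank_top, Module.finrank_self] at h1
  have h3 : LinearMap.ker (f.domRestrict M) = (LinearMap.ker f).comap M.subtype := by
    ext x; simp
  have h4 : Module.finrank ℝ ((LinearMap.ker f).comap M.subtype) = Module.finrank ℝ (M ⊓ LinearMap.ker f : Submodule ℝ _) := by
    rw [← Submodule.map_comap_subtype]
    exact (LinearEquiv.finrank_eq (Submodule.equivMapOfInjective _ M.injective_subtype _))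
  rw [h3, h4] at h1
  omega

open Classical in
lemma chiAux_open (hs : List (EuclideanSpace ℝ (Fin n))) (O : Set (EuclideanSpace ℝ (Fin n)))
    (hO : IsOpen O) (hc : Convex ℝ O) (M : Submodule ℝ (EuclideanSpace ℝ (Fin n))) :
    chiAux hs (O ∩ (M : Set _)) =
      if (O ∩ (M : Set (EuclideanSpace ℝ (Fin n)))).Nonempty then (-1) ^ Module.finrank ℝ M else 0 := by
  induction hs generalizing O M with
  | nil =>
    simp only [chiAux]
    split_ifs with h
    · rw [span_open_inter hO M h]
    · rfl
  | cons h hs ih =>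
    by_cases hne : (O ∩ (M : Set (EuclideanSpace ℝ (Fin n)))).Nonempty
    swap
    · rw [if_neg hne, not_nonempty_iff_eq_empty.1 hne, chiAux_empty]
    rw [if_pos hne]
    have hcont : Continuous fun x : EuclideanSpace ℝ (Fin n) => (inner ℝ x h : ℝ) := by fun_prop
    have e0 : O ∩ (M : Set (EuclideanSpace ℝ (Fin n))) ∩ {x | inner ℝ x h = 0}
        = O ∩ ((M ⊓ LinearMap.ker (formAux h) : Submodule ℝ _) : Set (EuclideanSpace ℝ (Fin n))) := by
      ext x
      simp [formAux_apply, and_assoc]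
    have op1 : IsOpen (O ∩ {x | 0 < (inner ℝ x h : ℝ)}) :=
      hO.inter (isOpen_lt continuous_const hcont)
    have op2 : IsOpen (O ∩ {x | (inner ℝ x h : ℝ) < 0}) :=
      hO.inter (isOpen_lt hcont continuous_const)
    have lin : IsLinearMap ℝ (fun x : EuclideanSpace ℝ (Fin n) => (inner ℝ x h : ℝ)) :=
      ⟨fun x y => inner_add_left x y h, fun c x => by simp [inner_smul_left]⟩
    have co1 : Convex ℝ (O ∩ {x | 0 < (inner ℝ x h : ℝ)}) :=
      hc.inter (convex_halfSpace_gt lin 0)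
    have co2 : Convex ℝ (O ∩ {x | (inner ℝ x h : ℝ) < 0}) :=
      hc.inter (convex_halfSpace_lt lin 0)
    simp only [chiAux]
    rw [e0, inter_right_comm O _ {x | 0 < inner ℝ x h}, inter_right_comm O _ {x | inner ℝ x h < 0},
      ih _ hO hc, ih _ op1 co1, ih _ op2 co2]
    by_cases hz : ∀ m ∈ M, (inner ℝ m h : ℝ) = 0
    · have e1 : M ⊓ LinearMap.ker (formAux h) = M := by
        apply inf_eq_left.2
        intro m hm
        simp [formAux_apply, hz m hm]
      rw [e1, if_pos hne, if_neg, if_neg]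
      · simp
      · rintro ⟨x, hx, hxM⟩
        have := hx.2
        simp [hz x hxM] at this
      · rintro ⟨x, hx, hxM⟩
        have := hx.2
        simp [hz x hxM] at this
    push Not at hz
    obtain ⟨m0, hm0, hm0'⟩ := hz
    obtain ⟨m, hm, hmpos⟩ : ∃ m ∈ M, 0 < (inner ℝ m h : ℝ) := by
      rcases lt_or_gt_of_ne hm0' with h1 | h1
      · exact ⟨-m0, M.neg_mem hm0, by rw [inner_neg_left]; linarith⟩
      · exact ⟨m0, hm0, h1⟩
    have hdim := finrank_inf_ker M (formAux h) hm0 (by rwa [formAux_apply])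
    by_cases hk : (O ∩ ((M ⊓ LinearMap.ker (formAux h) : Submodule ℝ _) : Set (EuclideanSpace ℝ (Fin n)))).Nonempty
    · obtain ⟨x, hxO, hxM⟩ := id hk
      have hxk : (inner ℝ x h : ℝ) = 0 := by
        rw [← formAux_apply]; exact hxM.2
      obtain ⟨ε, hε, h1, h2⟩ := exists_perturb hO hxO m
      rw [if_pos hk, if_pos, if_pos]
      · rw [← hdim]; ring
      · refine ⟨x - ε • m, ⟨h2, ?_⟩, M.sub_mem hxM.1 (M.smul_mem _ hm)⟩
        simp only [mem_ofPred_eq, inner_sub_left, hxk, real_inner_smul_left]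
        nlinarith
      · refine ⟨x + ε • m, ⟨h1, ?_⟩, M.add_mem hxM.1 (M.smul_mem _ hm)⟩
        simp only [mem_ofPred_eq, inner_add_left, hxk, real_inner_smul_left]
        nlinarith
    · rw [if_neg hk]
      have hnk : ∀ x ∈ O, x ∈ M → (inner ℝ x h : ℝ) ≠ 0 := by
        intro x hx hxM h0
        exact hk ⟨x, hx, hxM, by rw [SetLike.mem_coe, LinearMap.mem_ker, formAux_apply, h0]⟩
      have hnb : ∀ x ∈ O, x ∈ M → ∀ y ∈ O, y ∈ M → 0 < (inner ℝ x h : ℝ) → (inner ℝ y h : ℝ) < 0 → False := by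
        intro x hx hxM y hy hyM h1 h2
        set a : ℝ := inner ℝ x h
        set b : ℝ := inner ℝ y h
        have hab : 0 < a - b := by linarith
        have q1 : 0 ≤ (-b) / (a - b) := div_nonneg (by linarith) hab.le
        have q2 : 0 ≤ a / (a - b) := div_nonneg (by linarith) hab.le
        have q3 : (-b) / (a - b) + a / (a - b) = 1 := by field_simp; ring
        refine hnk _ (hc hx hy q1 q2 q3) (M.add_mem (M.smul_mem _ hxM) (M.smul_mem _ hyM)) ?_
        rw [inner_add_left, real_inner_smul_left, real_inner_smul_left]
        change (-b) / (a - b) * a + a / (a - b) * b = 0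
        field_simp
        ring
      obtain ⟨x, hxO, hxM⟩ := hne
      rcases lt_or_gt_of_ne (hnk x hxO hxM) with h1 | h1
      · rw [if_neg, if_pos]
        · simp
        · exact ⟨x, ⟨hxO, h1⟩, hxM⟩
        · rintro ⟨y, hy, hyM⟩
          exact hnb y hy.1 hyM x hxO hxM hy.2 h1
      · rw [if_pos, if_neg]
        · simp
        · rintro ⟨y, hy, hyM⟩
          exact hnb x hxO hxM y hy.1 hyM h1 hy.2
        · exact ⟨x, ⟨hxO, h1⟩, hxM⟩

open Classical in
/-- points of `S` maximizing the functional `x` -/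
noncomputable def argmaxAux (S : Finset (EuclideanSpace ℝ (Fin n))) (x : EuclideanSpace ℝ (Fin n)) :
    Finset (EuclideanSpace ℝ (Fin n)) :=
  S.filter fun p => ∀ q ∈ S, (inner ℝ x q : ℝ) ≤ inner ℝ x p

lemma mem_argmaxAux {S : Finset (EuclideanSpace ℝ (Fin n))} {x p : EuclideanSpace ℝ (Fin n)} :
    p ∈ argmaxAux S x ↔ p ∈ S ∧ ∀ q ∈ S, (inner ℝ x q : ℝ) ≤ inner ℝ x p := by
  simp [argmaxAux]

lemma argmaxAux_nonempty {S : Finset (EuclideanSpace ℝ (Fin n))} (hS : S.Nonempty)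
    (x : EuclideanSpace ℝ (Fin n)) : (argmaxAux S x).Nonempty := by
  obtain ⟨p, hp, h⟩ := S.exists_max_image (fun q => (inner ℝ x q : ℝ)) hS
  exact ⟨p, mem_argmaxAux.2 ⟨hp, h⟩⟩

/-- the open part of the stratum -/
def openAux (S Z : Finset (EuclideanSpace ℝ (Fin n))) : Set (EuclideanSpace ℝ (Fin n)) :=
  ⋂ p ∈ Z, ⋂ q ∈ {q | q ∈ S ∧ q ∉ Z}, {x | 0 < (inner ℝ x (p - q) : ℝ)}

lemma mem_openAux {S Z : Finset (EuclideanSpace ℝ (Fin n))} {x : EuclideanSpace ℝ (Fin n)} :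
    x ∈ openAux S Z ↔ ∀ p ∈ Z, ∀ q ∈ S, q ∉ Z → (inner ℝ x q : ℝ) < inner ℝ x p := by
  simp only [openAux, inner_sub_right, mem_iInter, mem_ofPred_eq, sub_pos, and_imp]

lemma isOpen_openAux (S Z : Finset (EuclideanSpace ℝ (Fin n))) : IsOpen (openAux S Z) := by
  unfold openAux
  refine isOpen_biInter_finset fun p _ => ?_
  refine (S.finite_toSet.subset (fun q hq => hq.1)).isOpen_biInter fun q _ => ?_
  exact isOpen_lt continuous_const (by fun_prop)

lemma convex_openAux (S Z : Finset (EuclideanSpace ℝ (Fin n))) : Convex ℝ (openAux S Z) := by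
  unfold openAux
  refine convex_iInter₂ fun p _ => convex_iInter₂ fun q _ => ?_
  exact convex_halfSpace_gt ⟨fun x y => inner_add_left x y _, fun c x => by simp [inner_smul_left]⟩ 0

lemma mem_vectorSpan_orth {Z : Set (EuclideanSpace ℝ (Fin n))} {x : EuclideanSpace ℝ (Fin n)} :
    x ∈ (vectorSpan ℝ Z)ᗮ ↔ ∀ p ∈ Z, ∀ q ∈ Z, (inner ℝ x p : ℝ) = inner ℝ x q := by
  rw [Submodule.mem_orthogonal']
  constructor
  · intro h p hp q hq
    have := h (p - q) (by simpa using vsub_mem_vectorSpan ℝ hp hq)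
    rw [inner_sub_right] at this
    linarith
  · intro h u hu
    have : vectorSpan ℝ Z ≤ LinearMap.ker (innerₛₗ ℝ x) := by
      unfold vectorSpan
      rw [Submodule.span_le]
      rintro _ ⟨p, hp, q, hq, rfl⟩
      simp [inner_sub_right, h p hp q hq]
    simpa using this hu

lemma stratum_eq {S Z : Finset (EuclideanSpace ℝ (Fin n))} (hZS : Z ⊆ S) (hZ : Z.Nonempty) :
    {x | argmaxAux S x = Z} = openAux S Z ∩ ((vectorSpan ℝ (Z : Set (EuclideanSpace ℝ (Fin n))))ᗮ : Submodule ℝ _) := by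
  ext x
  simp only [mem_ofPred_eq, mem_inter_iff, SetLike.mem_coe, mem_openAux, mem_vectorSpan_orth]
  constructor
  · rintro rfl
    refine ⟨fun p hp q hq hqn => ?_, fun p hp q hq => ?_⟩
    · by_contra hlt
      push Not at hlt
      exact hqn (mem_argmaxAux.2 ⟨hq, fun r hr => ((mem_argmaxAux.1 hp).2 r hr).trans hlt⟩)
    · exact le_antisymm ((mem_argmaxAux.1 hq).2 p (mem_argmaxAux.1 hp).1)
        ((mem_argmaxAux.1 hp).2 q (mem_argmaxAux.1 hq).1)
  · rintro ⟨h1, h2⟩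
    ext p
    rw [mem_argmaxAux]
    constructor
    · rintro ⟨hp, hmax⟩
      by_contra hpn
      obtain ⟨z, hz⟩ := hZ
      exact absurd (hmax z (hZS hz)) (not_le.2 (h1 z hz p hp hpn))
    · intro hp
      refine ⟨hZS hp, fun q hq => ?_⟩
      by_cases hqz : q ∈ Z
      · exact (h2 q hqz p hp).le
      · exact (h1 p hp q hq hqz).le

open Classical in
/-- The family of realized argmax sets. -/
noncomputable def realAux (S : Finset (EuclideanSpace ℝ (Fin n))) :
    Finset (Finset (EuclideanSpace ℝ (Fin n))) :=
  S.powerset.filter fun Z => ∃ x, argmaxAux S x = Z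

lemma pdim_convexHull (Z : Set (EuclideanSpace ℝ (Fin n))) :
    pdim (convexHull ℝ Z) = Module.finrank ℝ (vectorSpan ℝ Z) := by
  rw [pdim, affineSpan_convexHull, direction_affineSpan]

lemma sum_realAux (S : Finset (EuclideanSpace ℝ (Fin n))) (hS : S.Nonempty) :
    ∑ Z ∈ realAux S, (-1 : ℤ) ^ pdim (convexHull ℝ (Z : Set (EuclideanSpace ℝ (Fin n)))) = 1 := by
  classical
  set hs : List (EuclideanSpace ℝ (Fin n)) := ((S ×ˢ S).image fun pq => pq.1 - pq.2).toList with hhs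
  have h1 := chiAux_open hs univ isOpen_univ convex_univ ⊤
  have h2 := chiAux_sum S.powerset (argmaxAux S) hs univ
    (fun x _ => Finset.mem_powerset.2 (Finset.filter_subset _ _)) (by
      intro x _ y _ hxy
      ext p
      rw [mem_argmaxAux, mem_argmaxAux]
      refine and_congr_right fun hp => forall₂_congr fun q hq => ?_
      have hm : p - q ∈ hs := by
        rw [hhs, Finset.mem_toList, Finset.mem_image]
        exact ⟨(p, q), by simp [hp, hq], rfl⟩
      have := hxy _ hm
      rw [← sub_nonneg, ← inner_sub_right, ← sign_nonneg_iff, this, sign_nonneg_iff, inner_sub_right, sub_nonneg])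
  rw [if_pos (by simp)] at h1
  simp only [Submodule.top_coe, inter_univ, finrank_top, finrank_euclideanSpace_fin] at h1
  rw [h1] at h2
  have h3 : ∀ Z ∈ S.powerset, chiAux hs (univ ∩ {x | argmaxAux S x = Z}) =
      if (∃ x, argmaxAux S x = Z) then
        (-1 : ℤ) ^ n * (-1) ^ pdim (convexHull ℝ (Z : Set (EuclideanSpace ℝ (Fin n)))) else 0 := by
    intro Z hZ
    rw [univ_inter]
    by_cases hx : ∃ x, argmaxAux S x = Z
    · have hne : Z.Nonempty := by
        obtain ⟨x, rfl⟩ := hx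
        exact argmaxAux_nonempty hS x
      have hst := stratum_eq (Finset.mem_powerset.1 hZ) hne
      rw [if_pos hx, hst, chiAux_open _ _ (isOpen_openAux S Z) (convex_openAux S Z), if_pos (hst ▸ hx), pdim_convexHull]
      have := Submodule.finrank_add_finrank_orthogonal (vectorSpan ℝ (Z : Set (EuclideanSpace ℝ (Fin n))))
      rw [finrank_euclideanSpace_fin] at this
      set a := Module.finrank ℝ (vectorSpan ℝ (Z : Set (EuclideanSpace ℝ (Fin n))))
      conv_rhs => rw [← this]
      rw [pow_add, mul_right_comm, ← mul_pow]
      simp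
    · rw [if_neg hx]
      have : {x | argmaxAux S x = Z} = ∅ := by
        ext x
        simp only [mem_ofPred_eq, mem_empty_iff_false, iff_false]
        exact fun h => hx ⟨x, h⟩
      rw [this, chiAux_empty]
  rw [Finset.sum_congr rfl h3, ← Finset.sum_filter, ← Finset.mul_sum] at h2
  have h4 : ((-1 : ℤ) ^ n) ≠ 0 := by simp
  exact mul_left_cancel₀ h4 (by rw [mul_one]; exact h2.symm)

/-- a point of the hull attaining the maximal value is in the hull of maximizers -/
lemma face_eq_s5 (S : Finset (EuclideanSpace ℝ (Fin n))) (hS : S.Nonempty) (x : EuclideanSpace ℝ (Fin n)) :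
    {p ∈ convexHull ℝ (S : Set (EuclideanSpace ℝ (Fin n))) |
      ∀ q ∈ convexHull ℝ (S : Set (EuclideanSpace ℝ (Fin n))), (inner ℝ x q : ℝ) ≤ inner ℝ x p}
    = convexHull ℝ (argmaxAux S x : Set (EuclideanSpace ℝ (Fin n))) := by
  classical
  obtain ⟨z, hz⟩ := argmaxAux_nonempty hS x
  obtain ⟨hzS, hzmax⟩ := mem_argmaxAux.1 hz
  have lin : IsLinearMap ℝ (fun y : EuclideanSpace ℝ (Fin n) => (inner ℝ x y : ℝ)) :=
    ⟨fun y w => inner_add_right x y w, fun c y => by simp [inner_smul_right]⟩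
  have hle : ∀ q ∈ convexHull ℝ (S : Set (EuclideanSpace ℝ (Fin n))), (inner ℝ x q : ℝ) ≤ inner ℝ x z := by
    intro q hq
    exact convexHull_min (fun r hr => hzmax r hr) (convex_halfSpace_le lin (inner ℝ x z)) hq
  apply Subset.antisymm
  · rintro p ⟨hp, hpmax⟩
    have hpz : (inner ℝ x z : ℝ) ≤ inner ℝ x p := hpmax z (subset_convexHull ℝ _ hzS)
    rw [Finset.convexHull_eq] at hp
    obtain ⟨w, hw0, hw1, hwp⟩ := hp
    rw [Finset.centerMass_eq_of_sum_1 _ _ hw1] at hwp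
    have hval : ∑ y ∈ S, w y * ((inner ℝ x z : ℝ) - inner ℝ x y) ≤ 0 := by
      have e : (inner ℝ x p : ℝ) = ∑ y ∈ S, w y * inner ℝ x y := by
        rw [← hwp, inner_sum]
        simp [inner_smul_right]
      simp only [mul_sub, Finset.sum_sub_distrib, ← Finset.sum_mul, hw1, ← e]
      linarith
    have hnn : ∀ y ∈ S, 0 ≤ w y * ((inner ℝ x z : ℝ) - inner ℝ x y) := fun y hy =>
      mul_nonneg (hw0 y hy) (sub_nonneg.2 (hzmax y hy))
    have hz0 := (Finset.sum_eq_zero_iff_of_nonneg hnn).1 (le_antisymm hval (Finset.sum_nonneg hnn))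
    have hw' : ∀ y ∈ S, y ∉ argmaxAux S x → w y = 0 := by
      intro y hy hyn
      rcases mul_eq_zero.1 (hz0 y hy) with h | h
      · exact h
      · exact absurd (mem_argmaxAux.2 ⟨hy, fun q hq => (hzmax q hq).trans (by linarith)⟩) hyn
    have hsub : argmaxAux S x ⊆ S := Finset.filter_subset _ _
    have s1 : ∑ y ∈ argmaxAux S x, w y = 1 := by
      rw [← hw1]; exact Finset.sum_subset hsub hw'
    rw [Finset.convexHull_eq]
    refine ⟨w, fun y hy => hw0 y (hsub hy), s1, ?_⟩
    rw [Finset.centerMass_eq_of_sum_1 _ _ s1, ← hwp]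
    exact Finset.sum_subset hsub fun y hy hyn => by rw [hw' y hy hyn]; simp
  · intro p hp
    refine ⟨convexHull_mono (fun y hy => (mem_argmaxAux.1 hy).1) hp, fun q hq => (hle q hq).trans ?_⟩
    exact convexHull_min (t := {y | (inner ℝ x z : ℝ) ≤ inner ℝ x y})
      (fun r hr => (mem_argmaxAux.1 hr).2 z hzS) (convex_halfSpace_ge lin (inner ℝ x z)) hp

lemma convexHull_inter_argmax (S : Finset (EuclideanSpace ℝ (Fin n))) (hS : S.Nonempty) (x : EuclideanSpace ℝ (Fin n)) :
    convexHull ℝ (argmaxAux S x : Set (EuclideanSpace ℝ (Fin n))) ∩ S = argmaxAux S x := by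
  ext p
  constructor
  · rintro ⟨hp, hpS⟩
    rw [← face_eq_s5 S hS x] at hp
    exact mem_argmaxAux.2 ⟨hpS, fun q hq => hp.2 q (subset_convexHull ℝ _ hq)⟩
  · intro hp
    exact ⟨subset_convexHull ℝ _ hp, (mem_argmaxAux.1 hp).1⟩

lemma isFace_iff (S : Finset (EuclideanSpace ℝ (Fin n))) (hS : S.Nonempty) (F : Set (EuclideanSpace ℝ (Fin n))) :
    (IsExposed ℝ (convexHull ℝ (S : Set (EuclideanSpace ℝ (Fin n)))) F ∧ F.Nonempty) ↔
      ∃ Z ∈ realAux S, convexHull ℝ (Z : Set (EuclideanSpace ℝ (Fin n))) = F := by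
  constructor
  · rintro ⟨hF, hne⟩
    obtain ⟨l, hl⟩ := hF hne
    obtain ⟨x, rfl⟩ := (InnerProductSpace.toDual ℝ (EuclideanSpace ℝ (Fin n))).surjective l
    refine ⟨argmaxAux S x, ?_, ?_⟩
    · simp only [realAux, Finset.mem_filter, Finset.mem_powerset]
      exact ⟨Finset.filter_subset _ _, x, rfl⟩
    · rw [← face_eq_s5 S hS x, hl]
      simp
  · rintro ⟨Z, hZ, rfl⟩
    simp only [realAux, Finset.mem_filter, Finset.mem_powerset] at hZ
    obtain ⟨-, x, rfl⟩ := hZ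
    refine ⟨fun _ => ⟨InnerProductSpace.toDual ℝ (EuclideanSpace ℝ (Fin n)) x, ?_⟩, ?_⟩
    · rw [← face_eq_s5 S hS x]
      simp
    · exact convexHull_nonempty_iff.2 (argmaxAux_nonempty hS x)

end EulerAux

/-- Reduced Euler characteristic form: counting also the empty face (of dimension -1,
contributing (-1)^(-1) = -1), the alternating sum over all faces of P is 0. -/
theorem euler_poincare_reduced {n d : ℕ} (P : Set (EuclideanSpace ℝ (Fin n)))
    (hP : IsPolytope P) (hd : pdim P = d) :
    (-1 : ℤ) + ∑ c ∈ Finset.range (d + 1), (-1 : ℤ) ^ c * (fc P c : ℤ) = 0 := by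
  classical
  obtain ⟨S, hS, rfl⟩ := hP
  have hfc : ∀ c, fc (convexHull ℝ (S : Set (EuclideanSpace ℝ (Fin n)))) c =
      ((realAux S).filter fun Z : Finset (EuclideanSpace ℝ (Fin n)) => pdim (convexHull ℝ (Z : Set (EuclideanSpace ℝ (Fin n)))) = c).card := by
    intro c
    rw [fc, ← Set.ncard_coe_finset]
    have himg : {F | IsFaceDim (convexHull ℝ (S : Set (EuclideanSpace ℝ (Fin n)))) F c} =
        (fun Z : Finset (EuclideanSpace ℝ (Fin n)) => convexHull ℝ (Z : Set (EuclideanSpace ℝ (Fin n)))) ''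
          (((realAux S).filter fun Z : Finset (EuclideanSpace ℝ (Fin n)) => pdim (convexHull ℝ (Z : Set (EuclideanSpace ℝ (Fin n)))) = c : Finset _) : Set _) := by
      ext F
      simp only [mem_ofPred_eq, IsFaceDim, ← and_assoc, isFace_iff S hS, mem_image, Finset.coe_filter]
      constructor
      · rintro ⟨⟨Z, hZ, rfl⟩, hc⟩
        exact ⟨Z, ⟨hZ, hc⟩, rfl⟩
      · rintro ⟨Z, ⟨hZ, hc⟩, rfl⟩
        exact ⟨⟨Z, hZ, rfl⟩, hc⟩
    rw [himg]
    apply Set.InjOn.ncard_image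
    intro Z hZ Z' hZ' h
    simp only [Finset.coe_filter, mem_ofPred_eq, realAux, Finset.mem_filter] at hZ hZ'
    obtain ⟨⟨-, x, rfl⟩, -⟩ := hZ
    obtain ⟨⟨-, x', rfl⟩, -⟩ := hZ'
    dsimp only at h
    have h1 := convexHull_inter_argmax S hS x
    rw [h, convexHull_inter_argmax S hS x'] at h1
    exact (Finset.coe_injective h1).symm
  have hmaps : ∀ Z ∈ realAux S,
      pdim (convexHull ℝ (Z : Set (EuclideanSpace ℝ (Fin n)))) ∈ Finset.range (d + 1) := by
    intro Z hZ
    rw [Finset.mem_range, Nat.lt_succ_iff, ← hd, pdim_convexHull, pdim_convexHull]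
    apply Submodule.finrank_mono
    apply vectorSpan_mono
    simp only [realAux, Finset.mem_filter, Finset.mem_powerset] at hZ
    exact_mod_cast hZ.1
  have key := sum_realAux S hS
  rw [← Finset.sum_fiberwise_of_maps_to hmaps] at key
  have : ∑ c ∈ Finset.range (d + 1), (-1 : ℤ) ^ c * (fc (convexHull ℝ (S : Set (EuclideanSpace ℝ (Fin n)))) c : ℤ) = 1 := by
    refine Eq.trans (Finset.sum_congr rfl fun c _ => ?_) key
    have hc : ∀ Z ∈ (realAux S).filter fun Z : Finset (EuclideanSpace ℝ (Fin n)) =>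
          pdim (convexHull ℝ (Z : Set (EuclideanSpace ℝ (Fin n)))) = c,
        (-1 : ℤ) ^ pdim (convexHull ℝ (Z : Set (EuclideanSpace ℝ (Fin n)))) = (-1 : ℤ) ^ c := by
      intro Z hZ
      rw [(Finset.mem_filter.1 hZ).2]
    rw [hfc, Finset.sum_congr rfl hc]
    simp [mul_comm]
  rw [this]
  norm_num
end
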